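/- arXiv:2503.23915 — 8 statements merged into one kernel-verified Lean document; each statement's English description precedes it below -/
import Mathlib

section
/- Let I ⊂ ℝ be an interval and A : I → ℂ^{n×n}. If A is differentiable on I, satisfies A_x(x) = A(x)² and A(x) is invertible for every x ∈ I, then there exists B ∈ ℂ^{n×n} such that A(x) = (B − x I_n)^{−1} for all x ∈ I; in particular B − x I_n is invertible for all x ∈ I. Conversely, if B ∈ ℂ^{n×n} is such that B − x I_n is invertible for all x ∈ I and A(x) := (B − x I_n)^{−1}, then A is differentiable and invertible on I and satisfies A_x = A². -/
open Matrix

attribute [local instance] Matrix.normedAddCommGroup Matrix.normedSpace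

theorem HasDerivAt.ringInverse {R : Type*} [NormedRing R] [HasSummableGeomSeries R]
    [NormedAlgebra ℝ R] {f : ℝ → R} {f' : R} {x : ℝ} (hf : HasDerivAt f f' x)
    (hx : IsUnit (f x)) :
    HasDerivAt (fun t => Ring.inverse (f t))
      (-(Ring.inverse (f x) * f' * Ring.inverse (f x))) x := by
  obtain ⟨u, hu⟩ := hx
  have h : HasFDerivAt Ring.inverse _ (f x) := hu ▸ hasFDerivAt_ringInverse (𝕜 := ℝ) u
  have h' := h.comp_hasDerivAt x hf
  rw [← hu, Ring.inverse_unit]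
  simpa [Function.comp_def] using h'

theorem Matrix.hasDerivAt_inv {n : ℕ} {f : ℝ → Matrix (Fin n) (Fin n) ℂ}
    {f' : Matrix (Fin n) (Fin n) ℂ} {x : ℝ} (hf : HasDerivAt f f' x) (hx : IsUnit (f x)) :
    HasDerivAt (fun t => (f t)⁻¹) (-((f x)⁻¹ * f' * (f x)⁻¹)) x := by
  let R := Matrix (Fin n) (Fin n) ℂ
  let ring : NormedRing R := Matrix.linftyOpNormedRing
  let : NormedAlgebra ℝ R := Matrix.linftyOpNormedAlgebra
  have : @CompleteSpace R ring.toMetricSpace.toUniformSpace :=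
    inferInstanceAs (CompleteSpace (Fin n → Fin n → ℂ))
  simp only [Matrix.nonsing_inv_eq_ringInverse]
  exact HasDerivAt.ringInverse (R := R) hf hx

theorem Matrix.hasDerivAt_ofReal_smul_one {n : ℕ} (x : ℝ) :
    HasDerivAt (fun t : ℝ => (t : ℂ) • (1 : Matrix (Fin n) (Fin n) ℂ)) 1 x := by
  have h := (Complex.ofRealCLM.hasDerivAt (x := x)).smul_const (1 : Matrix (Fin n) (Fin n) ℂ)
  rw [Complex.ofRealCLM_apply, Complex.ofReal_one, one_smul] at h
  exact h

/-- on an interval, solutions of `A_x = A²` which are invertible are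
exactly the resolvents `A(x) = (B − x Iₙ)⁻¹` (Remark 2.1). -/
theorem stmt_1 {n : ℕ} (I : Set ℝ) (hI : I.OrdConnected) :
    (∀ A : ℝ → Matrix (Fin n) (Fin n) ℂ,
      (∀ x ∈ I, HasDerivAt A (A x * A x) x) →
      (∀ x ∈ I, IsUnit (A x)) →
      ∃ B : Matrix (Fin n) (Fin n) ℂ, ∀ x ∈ I,
        IsUnit (B - (x : ℂ) • (1 : Matrix (Fin n) (Fin n) ℂ)) ∧
          A x = (B - (x : ℂ) • (1 : Matrix (Fin n) (Fin n) ℂ))⁻¹)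
    ∧
    (∀ B : Matrix (Fin n) (Fin n) ℂ,
      (∀ x ∈ I, IsUnit (B - (x : ℂ) • (1 : Matrix (Fin n) (Fin n) ℂ))) →
      ∀ x ∈ I,
        HasDerivAt (fun t : ℝ => (B - (t : ℂ) • (1 : Matrix (Fin n) (Fin n) ℂ))⁻¹)
          ((B - (x : ℂ) • (1 : Matrix (Fin n) (Fin n) ℂ))⁻¹ *
            (B - (x : ℂ) • (1 : Matrix (Fin n) (Fin n) ℂ))⁻¹) x ∧
        IsUnit ((B - (x : ℂ) • (1 : Matrix (Fin n) (Fin n) ℂ))⁻¹)) := by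
  refine ⟨fun A hA hu => ?_, fun B hB x hx => ⟨?_, ?_⟩⟩
  · rcases I.eq_empty_or_nonempty with rfl | ⟨x₀, hx₀⟩
    · exact ⟨0, by simp⟩
    have hderiv : ∀ x ∈ I, HasDerivAt
        (fun t : ℝ => (A t)⁻¹ + (t : ℂ) • (1 : Matrix (Fin n) (Fin n) ℂ)) 0 x := by
      intro x hx
      have hdet := (Matrix.isUnit_iff_isUnit_det _).1 (hu x hx)
      have h := (Matrix.hasDerivAt_inv (hA x hx) (hu x hx)).add
        (Matrix.hasDerivAt_ofReal_smul_one x)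
      rwa [← Matrix.mul_assoc, Matrix.nonsing_inv_mul _ hdet, Matrix.one_mul,
        Matrix.mul_nonsing_inv _ hdet, neg_add_cancel] at h
    refine ⟨(A x₀)⁻¹ + (x₀ : ℂ) • 1, fun x hx => ?_⟩
    have hdet := (Matrix.isUnit_iff_isUnit_det _).1 (hu x hx)
    have hle := hI.convex.norm_image_sub_le_of_norm_hasDerivWithin_le (C := 0)
      (fun y hy => (hderiv y hy).hasDerivWithinAt) (fun _ _ => by simp) hx₀ hx
    rw [zero_mul, norm_le_zero_iff, sub_eq_zero] at hle
    rw [← hle, add_sub_cancel_right, Matrix.nonsing_inv_nonsing_inv _ hdet]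
    exact ⟨Matrix.isUnit_nonsing_inv_iff.2 (hu x hx), rfl⟩
  · have h := Matrix.hasDerivAt_inv
      ((Matrix.hasDerivAt_ofReal_smul_one x).const_sub B) (hB x hx)
    simpa using h
  · exact Matrix.isUnit_nonsing_inv_iff.2 (hB x hx)
end

section
/- Let J ∈ ℂ^{m×m} with J = J* = J^{−1}, let A, S ∈ ℂ^{n×n} with S = S* invertible, and Π ∈ ℂ^{n×m} satisfy the identity A S − S A* = i Π J Π*. Let λ ∈ ℂ be such that A − λ I_n and A − λ̄ I_n are invertible, and define w_A(λ) = I_m − i J Π* S^{−1} (A − λ I_n)^{−1} Π. Then w_A(λ̄)* J w_A(λ) = J; in particular, w_A(λ) is invertible and w_A(λ)^{−1} = J w_A(λ̄)* J. -/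
open Matrix

/-- The transfer matrix function in Lev Sakhnovich form,
`w_A(λ) = I_m − i J Π* S⁻¹ (A − λ Iₙ)⁻¹ Π`. -/
noncomputable def transferMatrix {m n : ℕ} (J : Matrix (Fin m) (Fin m) ℂ)
    (A S : Matrix (Fin n) (Fin n) ℂ) (Φ : Matrix (Fin n) (Fin m) ℂ) (l : ℂ) :
    Matrix (Fin m) (Fin m) ℂ :=
  1 - Complex.I • (J * Φᴴ * S⁻¹ * (A - l • (1 : Matrix (Fin n) (Fin n) ℂ))⁻¹ * Φ)

/-- The resolvent identity behind the J-property: `R = (A - l)⁻¹`, `Q = (Aᴴ - l)⁻¹`, `T = S⁻¹`. -/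
theorem resolvent_sandwich {n : ℕ} {A B S T R Q : Matrix (Fin n) (Fin n) ℂ} {l : ℂ}
    (hST : S * T = 1) (hTS : T * S = 1) (hR : (A - l • 1) * R = 1) (hQ : Q * (B - l • 1) = 1) :
    Q * T * (A * S - S * B) * T * R = Q * T - T * R := by
  have hsplit : A * S - S * B = (A - l • 1) * S - S * (B - l • 1) := by
    simp [sub_mul, mul_sub]
  calc Q * T * (A * S - S * B) * T * R
      = Q * T * (A - l • 1) * (S * T) * R - Q * (T * S) * (B - l • 1) * T * R := by
        rw [hsplit]; noncomm_ring
    _ = Q * T * ((A - l • 1) * R) - Q * (B - l • 1) * (T * R) := by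
        rw [hST, hTS]; noncomm_ring
    _ = Q * T - T * R := by rw [hR, hQ, mul_one, one_mul]

/-- the J-property (1.7') of the transfer matrix function. -/
theorem stmt_3 {m n : ℕ} (J : Matrix (Fin m) (Fin m) ℂ)
    (hJherm : Jᴴ = J) (hJinv : J * J = 1)
    (A S : Matrix (Fin n) (Fin n) ℂ) (hSherm : S = Sᴴ) (hSinv : IsUnit S)
    (Φ : Matrix (Fin n) (Fin m) ℂ)
    (hid : A * S - S * Aᴴ = Complex.I • (Φ * J * Φᴴ))
    (lam : ℂ)
    (h1 : IsUnit (A - lam • (1 : Matrix (Fin n) (Fin n) ℂ)))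
    (h2 : IsUnit (A - (starRingEnd ℂ lam) • (1 : Matrix (Fin n) (Fin n) ℂ))) :
    (transferMatrix J A S Φ (starRingEnd ℂ lam))ᴴ * J * transferMatrix J A S Φ lam = J
    ∧ IsUnit (transferMatrix J A S Φ lam)
    ∧ (transferMatrix J A S Φ lam)⁻¹ =
        J * (transferMatrix J A S Φ (starRingEnd ℂ lam))ᴴ * J := by
  have hSdet := (isUnit_iff_isUnit_det S).mp hSinv
  have hsandwich := resolvent_sandwich (B := Aᴴ) (mul_nonsing_inv S hSdet)
    (nonsing_inv_mul S hSdet) (mul_nonsing_inv _ ((isUnit_iff_isUnit_det _).mp h1))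
    (Q := ((A - (starRingEnd ℂ lam) • (1 : Matrix (Fin n) (Fin n) ℂ))⁻¹)ᴴ) (by
      have h := congrArg conjTranspose
        (mul_nonsing_inv _ ((isUnit_iff_isUnit_det _).mp h2))
      simpa [conjTranspose_mul, conjTranspose_sub, conjTranspose_smul] using h)
  have hStar : (S⁻¹)ᴴ = S⁻¹ := by rw [conjTranspose_nonsing_inv, ← hSherm]
  have hJ : (transferMatrix J A S Φ (starRingEnd ℂ lam))ᴴ * J * transferMatrix J A S Φ lam
      = J := by
    unfold transferMatrix
    set R := (A - lam • (1 : Matrix (Fin n) (Fin n) ℂ))⁻¹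
    set Q := (A - (starRingEnd ℂ lam) • (1 : Matrix (Fin n) (Fin n) ℂ))⁻¹
    have hadj : (1 - Complex.I • (J * Φᴴ * S⁻¹ * Q * Φ))ᴴ
        = 1 + Complex.I • (Φᴴ * Qᴴ * S⁻¹ * Φ * J) := by
      simp [conjTranspose_mul, hStar, hJherm, Matrix.mul_assoc]
    have hquad : Φᴴ * Qᴴ * S⁻¹ * (Complex.I • (Φ * J * Φᴴ)) * S⁻¹ * R * Φ
        = Φᴴ * Qᴴ * S⁻¹ * Φ - Φᴴ * S⁻¹ * R * Φ := by
      have h := congrArg (fun X => Φᴴ * X * Φ) hsandwich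
      rw [hid] at h
      simpa only [Matrix.mul_assoc, Matrix.mul_sub, Matrix.sub_mul] using h
    have hJJ (k : ℕ) (X : Matrix (Fin m) (Fin k) ℂ) : J * (J * X) = X := by
      rw [← Matrix.mul_assoc, hJinv, Matrix.one_mul]
    rw [hadj]
    simp only [Matrix.mul_assoc, Matrix.mul_smul, Matrix.smul_mul] at hquad
    simp only [Matrix.mul_assoc, Matrix.mul_smul, Matrix.smul_mul, Matrix.add_mul,
      Matrix.mul_sub, Matrix.one_mul, Matrix.mul_one, hJinv, hJJ, hquad, smul_sub, smul_add]
    abel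
  have hleft : J * (transferMatrix J A S Φ (starRingEnd ℂ lam))ᴴ * J
      * transferMatrix J A S Φ lam = 1 := by
    rw [Matrix.mul_assoc J, Matrix.mul_assoc J, hJ, hJinv]
  exact ⟨hJ, IsUnit.of_mul_eq_one_right _ hleft, inv_eq_left_inv hleft⟩
end

section
/- Let J ∈ ℂ^{m×m} with J = J* = J^{−1}, let A, S ∈ ℂ^{n×n} be invertible with S = S*, and let Π ∈ ℂ^{n×m} satisfy A S − S A* = i Π J Π*. Define w_0 = I_m − i J Π* S^{−1} A^{−1} Π. Then w_0 J w_0* = J; in particular w_0 is invertible and w_0^{−1} = I_m + i J Π* (A*)^{−1} S^{−1} Π. -/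
open Matrix

/-- If `A S - S B = i Ψ X` with `A`, `B`, `S` invertible, the transfer matrices at infinity attached
to `A` and to `B` are inverse to each other. -/
theorem one_sub_mul_one_add_eq_one {m n : Type*} [Fintype m] [DecidableEq m] [Fintype n]
    [DecidableEq n] {A B S : Matrix n n ℂ} (hA : IsUnit A) (hB : IsUnit B) (hS : IsUnit S)
    {X : Matrix m n ℂ} {Ψ : Matrix n m ℂ} (h : A * S - S * B = Complex.I • (Ψ * X)) :
    (1 - Complex.I • (X * S⁻¹ * A⁻¹ * Ψ)) * (1 + Complex.I • (X * B⁻¹ * S⁻¹ * Ψ)) = 1 := by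
  rw [Matrix.isUnit_iff_isUnit_det] at hA hB hS
  have hres : S⁻¹ * A⁻¹ * (A * S - S * B) * (B⁻¹ * S⁻¹) = B⁻¹ * S⁻¹ - S⁻¹ * A⁻¹ := by
    have h₁ : S⁻¹ * A⁻¹ * (A * S) = 1 := by
      rw [Matrix.mul_assoc, Matrix.nonsing_inv_mul_cancel_left _ _ hA, Matrix.nonsing_inv_mul _ hS]
    have h₂ : S * B * (B⁻¹ * S⁻¹) = 1 := by
      rw [Matrix.mul_assoc, Matrix.mul_nonsing_inv_cancel_left _ _ hB, Matrix.mul_nonsing_inv _ hS]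
    rw [Matrix.mul_sub, Matrix.sub_mul, h₁, Matrix.one_mul, Matrix.mul_assoc _ (S * B), h₂,
      Matrix.mul_one]
  have hprod : Complex.I • (X * S⁻¹ * A⁻¹ * Ψ * (X * B⁻¹ * S⁻¹ * Ψ)) =
      X * B⁻¹ * S⁻¹ * Ψ - X * S⁻¹ * A⁻¹ * Ψ := by
    have := congrArg (fun M => X * M * Ψ) hres
    rw [h] at this
    simpa only [Matrix.mul_smul, Matrix.smul_mul, Matrix.mul_sub, Matrix.sub_mul,
      Matrix.mul_assoc] using this
  rw [Matrix.mul_add, Matrix.mul_one, Matrix.sub_mul, Matrix.one_mul, Matrix.smul_mul,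
    Matrix.mul_smul, hprod, smul_sub]
  abel

/-- the J-unitarity (2.9) of `w₀ = I_m − i J Π* S⁻¹ A⁻¹ Π` and the
formula (1.12) for its inverse. -/
theorem stmt_4 {m n : ℕ} (J : Matrix (Fin m) (Fin m) ℂ)
    (hJherm : Jᴴ = J) (hJinv : J * J = 1)
    (A S : Matrix (Fin n) (Fin n) ℂ) (hAinv : IsUnit A) (hSinv : IsUnit S)
    (hSherm : S = Sᴴ)
    (Φ : Matrix (Fin n) (Fin m) ℂ)
    (hid : A * S - S * Aᴴ = Complex.I • (Φ * J * Φᴴ)) :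
    (1 - Complex.I • (J * Φᴴ * S⁻¹ * A⁻¹ * Φ)) * J *
        (1 - Complex.I • (J * Φᴴ * S⁻¹ * A⁻¹ * Φ))ᴴ = J
    ∧ IsUnit (1 - Complex.I • (J * Φᴴ * S⁻¹ * A⁻¹ * Φ))
    ∧ (1 - Complex.I • (J * Φᴴ * S⁻¹ * A⁻¹ * Φ))⁻¹ =
        1 + Complex.I • (J * Φᴴ * (Aᴴ)⁻¹ * S⁻¹ * Φ) := by
  have hmul := one_sub_mul_one_add_eq_one (X := J * Φᴴ) (Ψ := Φ) (B := Aᴴ) hAinv hAinv.star hSinv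
    (by rw [hid, Matrix.mul_assoc])
  have hadj : J * (1 - Complex.I • (J * Φᴴ * S⁻¹ * A⁻¹ * Φ))ᴴ =
      (1 + Complex.I • (J * Φᴴ * (Aᴴ)⁻¹ * S⁻¹ * Φ)) * J := by
    simp [Matrix.conjTranspose_nonsing_inv, ← hSherm, hJherm, Matrix.mul_add, Matrix.add_mul,
      Matrix.mul_assoc]
  refine ⟨?_, IsUnit.of_mul_eq_one _ hmul, Matrix.inv_eq_right_inv hmul⟩
  rw [Matrix.mul_assoc, hadj, ← Matrix.mul_assoc, hmul, Matrix.one_mul]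
end

section
/- Let I ⊂ ℝ be an interval, J ∈ ℂ^{m×m} with J = J* = J^{−1}, and H : I → ℂ^{m×m} continuous with H(x) positive semidefinite. Let B ∈ ℂ^{n×n} with B − x I_n invertible for all x ∈ I, set A(x) = (B − x I_n)^{−1}, and let Π : I → ℂ^{n×m}, S : I → ℂ^{n×n} be differentiable and satisfy Π_x = −i A Π J H, S_x = Π J H J* Π* − (A S + S A*), with S(ξ) = S(ξ)* and A(ξ)S(ξ) − S(ξ)A(ξ)* = i Π(ξ) J Π(ξ)* for some ξ ∈ I, and with S(x) invertible for all x ∈ I. Let z ∈ ℂ with z ∉ I and B − z I_n, B − z̄ I_n invertible, and let W : I → ℂ^{m×m} be differentiable with W_x(x) = i(z−x)^{−1} J H(x) W(x). Set w_A(x,z) = I_m − i J Π(x)* S(x)^{−1} (A(x) − (z−x)^{−1} I_n)^{−1} Π(x), w_0(x) = I_m − i J Π(x)* S(x)^{−1} A(x)^{−1} Π(x), v(x,z) = w_0(x)^{−1} w_A(x,z), and H̃(x) = w_0(x)* H(x) w_0(x). Then the matrix function w̃(x) := v(x,z) W(x) is differentiable on I and satisfies the transformed canonical system w̃_x(x)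 = i(z−x)^{−1} J H̃(x) w̃(x). -/
open Matrix
open scoped ComplexOrder

attribute [local instance] Matrix.normedAddCommGroup Matrix.normedSpace

/-- `A(x) = (B − x Iₙ)⁻¹`. -/
noncomputable def Amat {n : ℕ} (B : Matrix (Fin n) (Fin n) ℂ) (x : ℝ) :
    Matrix (Fin n) (Fin n) ℂ :=
  (B - (x : ℂ) • (1 : Matrix (Fin n) (Fin n) ℂ))⁻¹

/-- `w_A(x,z) = I_m − i J Π(x)* S(x)⁻¹ (A(x) − (z−x)⁻¹ Iₙ)⁻¹ Π(x)`. -/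
noncomputable def wAfun {m n : ℕ} (J : Matrix (Fin m) (Fin m) ℂ)
    (B : Matrix (Fin n) (Fin n) ℂ) (S : ℝ → Matrix (Fin n) (Fin n) ℂ)
    (Φ : ℝ → Matrix (Fin n) (Fin m) ℂ) (z : ℂ) (x : ℝ) :
    Matrix (Fin m) (Fin m) ℂ :=
  1 - Complex.I • (J * (Φ x)ᴴ * (S x)⁻¹ *
    (Amat B x - (z - (x : ℂ))⁻¹ • (1 : Matrix (Fin n) (Fin n) ℂ))⁻¹ * Φ x)

/-- `w₀(x) = I_m − i J Π(x)* S(x)⁻¹ A(x)⁻¹ Π(x)`. -/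
noncomputable def w0fun {m n : ℕ} (J : Matrix (Fin m) (Fin m) ℂ)
    (B : Matrix (Fin n) (Fin n) ℂ) (S : ℝ → Matrix (Fin n) (Fin n) ℂ)
    (Φ : ℝ → Matrix (Fin n) (Fin m) ℂ) (x : ℝ) : Matrix (Fin m) (Fin m) ℂ :=
  1 - Complex.I • (J * (Φ x)ᴴ * (S x)⁻¹ * (Amat B x)⁻¹ * Φ x)

/-- `v(x,z) = w₀(x)⁻¹ w_A(x,z)`. -/
noncomputable def vfun {m n : ℕ} (J : Matrix (Fin m) (Fin m) ℂ)
    (B : Matrix (Fin n) (Fin n) ℂ) (S : ℝ → Matrix (Fin n) (Fin n) ℂ)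
    (Φ : ℝ → Matrix (Fin n) (Fin m) ℂ) (z : ℂ) (x : ℝ) :
    Matrix (Fin m) (Fin m) ℂ :=
  (w0fun J B S Φ x)⁻¹ * wAfun J B S Φ z x

section MatrixCalculus

variable {k l p : ℕ} {x : ℝ}

theorem hasDerivAt_matrix_iff {F : ℝ → Matrix (Fin k) (Fin l) ℂ} {F' : Matrix (Fin k) (Fin l) ℂ} :
    HasDerivAt F F' x ↔ ∀ i j, HasDerivAt (fun t => F t i j) (F' i j) x :=
  (hasDerivAt_pi (φ := F) (φ' := F')).trans (forall_congr' fun _ => hasDerivAt_pi)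

theorem HasDerivAt.matrix_mul {F : ℝ → Matrix (Fin k) (Fin l) ℂ} {F' : Matrix (Fin k) (Fin l) ℂ}
    {G : ℝ → Matrix (Fin l) (Fin p) ℂ} {G' : Matrix (Fin l) (Fin p) ℂ}
    (hF : HasDerivAt F F' x) (hG : HasDerivAt G G' x) :
    HasDerivAt (fun t => F t * G t) (F' * G x + F x * G') x := by
  rw [hasDerivAt_matrix_iff] at *
  intro i j
  simp only [Matrix.mul_apply, Matrix.add_apply, ← Finset.sum_add_distrib]
  exact HasDerivAt.fun_sum fun a _ => (hF i a).mul (hG a j)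

theorem HasDerivAt.matrix_conjTranspose {F : ℝ → Matrix (Fin k) (Fin l) ℂ}
    {F' : Matrix (Fin k) (Fin l) ℂ} (hF : HasDerivAt F F' x) :
    HasDerivAt (fun t => (F t)ᴴ) F'ᴴ x := by
  rw [hasDerivAt_matrix_iff] at *
  exact fun i j => (hF j i).star

theorem HasDerivAt.matrix_inv {F : ℝ → Matrix (Fin k) (Fin k) ℂ} {F' : Matrix (Fin k) (Fin k) ℂ}
    (hF : HasDerivAt F F' x) (hx : IsUnit (F x)) :
    HasDerivAt (fun t => (F t)⁻¹) (-((F x)⁻¹ * F' * (F x)⁻¹)) x := by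
  have hdet : (F x).det ≠ 0 := ((Matrix.isUnit_iff_isUnit_det _).1 hx).ne_zero
  have hcont : ContinuousAt F x := hF.continuousAt
  have hinv : ContinuousAt (fun t => (F t)⁻¹) x :=
    (continuousAt_matrix_inv (F x) (NormedRing.inverse_continuousAt
      (Units.mk0 _ hdet))).comp hcont
  have hev : ∀ᶠ t in nhds x, IsUnit (F t) := by
    have hc : ContinuousAt (fun t => (F t).det) x :=
      (Continuous.matrix_det continuous_id).continuousAt.comp hcont
    filter_upwards [hc.eventually_ne hdet] with t ht
    exact (Matrix.isUnit_iff_isUnit_det _).2 (isUnit_iff_ne_zero.2 ht)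
  have hF' := hasDerivAt_iff_tendsto_slope.1 hF
  refine hasDerivAt_iff_tendsto_slope.2 ?_
  have hlim : Filter.Tendsto (fun t => -((F t)⁻¹ * slope F x t * (F x)⁻¹))
      (nhdsWithin x {x}ᶜ) (nhds (-((F x)⁻¹ * F' * (F x)⁻¹))) := by
    refine Filter.Tendsto.neg (Filter.Tendsto.mul (Filter.Tendsto.mul ?_ hF') tendsto_const_nhds)
    exact hinv.tendsto.mono_left nhdsWithin_le_nhds
  refine hlim.congr' ?_
  filter_upwards [nhdsWithin_le_nhds hev] with t ht
  have h1 := (Matrix.isUnit_iff_isUnit_det _).1 ht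
  have h2 := (Matrix.isUnit_iff_isUnit_det _).1 hx
  simp only [slope_def_module, Matrix.mul_smul, Matrix.smul_mul, Matrix.mul_sub, Matrix.sub_mul,
    Matrix.nonsing_inv_mul _ h1, Matrix.one_mul, Matrix.mul_assoc, Matrix.mul_nonsing_inv _ h2,
    Matrix.mul_one]
  rw [← smul_neg, neg_sub]

theorem Set.OrdConnected.eq_of_hasDerivAt_zero {I : Set ℝ} (hI : I.OrdConnected)
    {F : ℝ → Matrix (Fin k) (Fin l) ℂ} (hF : ∀ x ∈ I, HasDerivAt F 0 x) {a b : ℝ}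
    (ha : a ∈ I) (hb : b ∈ I) : F a = F b := by
  have h := hI.convex.norm_image_sub_le_of_norm_hasDerivWithin_le (C := 0)
    (fun x hx => (hF x hx).hasDerivWithinAt) (by simp) hb ha
  simpa [sub_eq_zero] using h

end MatrixCalculus

section Transform

variable {m n : ℕ} {B : Matrix (Fin n) (Fin n) ℂ} {x : ℝ}

theorem hasDerivAt_sub_smul_one : HasDerivAt
    (fun t : ℝ => B - (t : ℂ) • (1 : Matrix (Fin n) (Fin n) ℂ)) (-1) x := by
  have h := (Complex.ofRealCLM.hasDerivAt (x := x)).smul_const (1 : Matrix (Fin n) (Fin n) ℂ)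
  exact (h.const_sub B).congr_deriv (by simp)

theorem hasDerivAt_Amat (hB : IsUnit (B - (x : ℂ) • (1 : Matrix (Fin n) (Fin n) ℂ))) :
    HasDerivAt (Amat B) (Amat B x * Amat B x) x := by
  exact (hasDerivAt_sub_smul_one.matrix_inv hB).congr_deriv (by simp [Amat])

theorem hasDerivAt_resolvent {A : ℝ → Matrix (Fin n) (Fin n) ℂ} {c : ℝ → ℂ}
    (hA : HasDerivAt A (A x * A x) x) (hc : HasDerivAt c (c x * c x) x)
    (hu : IsUnit (A x - c x • (1 : Matrix (Fin n) (Fin n) ℂ))) :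
    HasDerivAt (fun t => (A t - c t • (1 : Matrix (Fin n) (Fin n) ℂ))⁻¹)
      (-1 - (2 * c x) • (A x - c x • (1 : Matrix (Fin n) (Fin n) ℂ))⁻¹) x := by
  have h := (hA.sub (hc.smul_const (1 : Matrix (Fin n) (Fin n) ℂ))).matrix_inv hu
  refine h.congr_deriv ?_
  have h2 := (Matrix.isUnit_iff_isUnit_det _).1 hu
  have e : A x * A x - (c x * c x) • (1 : Matrix (Fin n) (Fin n) ℂ) =
      (A x - c x • 1) * (A x - c x • 1) + (2 * c x) • (A x - c x • 1) := by
    simp only [Matrix.mul_sub, Matrix.sub_mul, Matrix.mul_smul, Matrix.smul_mul, Matrix.mul_one,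
      Matrix.one_mul]
    module
  simp only [Pi.sub_apply]
  rw [e, Matrix.mul_add, Matrix.add_mul, Matrix.mul_smul, Matrix.nonsing_inv_mul_cancel_left _ _ h2,
    Matrix.nonsing_inv_mul _ h2, Matrix.mul_nonsing_inv _ h2, Matrix.smul_mul, Matrix.one_mul]
  abel


theorem isHermitian_of_hasDerivAt {I : Set ℝ} (hI : I.OrdConnected)
    {A S K : ℝ → Matrix (Fin n) (Fin n) ℂ}
    (hA : ∀ x ∈ I, HasDerivAt A (A x * A x) x) (hAu : ∀ x ∈ I, IsUnit (A x))
    (hK : ∀ x ∈ I, (K x)ᴴ = K x)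
    (hS : ∀ x ∈ I, HasDerivAt S (K x - (A x * S x + S x * (A x)ᴴ)) x)
    {ξ : ℝ} (hξ : ξ ∈ I) (hSξ : S ξ = (S ξ)ᴴ) (hx : x ∈ I) : (S x)ᴴ = S x := by
  have h0 : ∀ y ∈ I, HasDerivAt (fun t => A t * (S t - (S t)ᴴ) * (A t)ᴴ) 0 y := by
    intro y hy
    refine (((hA y hy).matrix_mul ((hS y hy).sub (hS y hy).matrix_conjTranspose)).matrix_mul
      (hA y hy).matrix_conjTranspose).congr_deriv ?_
    simp only [Pi.sub_apply, Matrix.conjTranspose_add, Matrix.conjTranspose_sub,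
      Matrix.conjTranspose_mul, Matrix.conjTranspose_conjTranspose, hK y hy]
    noncomm_ring
  have h := hI.eq_of_hasDerivAt_zero h0 hx hξ
  rw [← hSξ, sub_self, Matrix.mul_zero, Matrix.zero_mul] at h
  have hu : IsUnit (A x)ᴴ := (hAu x hx).star
  have h1 := hu.mul_left_eq_zero.1 h
  have h2 := (hAu x hx).mul_right_eq_zero.1 h1
  exact (sub_eq_zero.1 h2).symm

theorem operator_identity_of_hasDerivAt {I : Set ℝ} (hI : I.OrdConnected)
    {J : Matrix (Fin m) (Fin m) ℂ} (hJ : Jᴴ = J) {H : ℝ → Matrix (Fin m) (Fin m) ℂ}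
    (hH : ∀ x ∈ I, (H x)ᴴ = H x) {A S : ℝ → Matrix (Fin n) (Fin n) ℂ}
    {Φ : ℝ → Matrix (Fin n) (Fin m) ℂ}
    (hA : ∀ x ∈ I, HasDerivAt A (A x * A x) x)
    (hΦ : ∀ x ∈ I, HasDerivAt Φ (-(Complex.I • (A x * Φ x * J * H x))) x)
    (hS : ∀ x ∈ I, HasDerivAt S
      (Φ x * J * H x * Jᴴ * (Φ x)ᴴ - (A x * S x + S x * (A x)ᴴ)) x)
    {ξ : ℝ} (hξ : ξ ∈ I)
    (hid : A ξ * S ξ - S ξ * (A ξ)ᴴ = Complex.I • (Φ ξ * J * (Φ ξ)ᴴ)) (hx : x ∈ I) :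
    A x * S x - S x * (A x)ᴴ = Complex.I • (Φ x * J * (Φ x)ᴴ) := by
  have h0 : ∀ y ∈ I, HasDerivAt (fun t => A t * S t - S t * (A t)ᴴ -
      Complex.I • (Φ t * J * (Φ t)ᴴ)) 0 y := by
    intro y hy
    refine ((((hA y hy).matrix_mul (hS y hy)).sub
      ((hS y hy).matrix_mul (hA y hy).matrix_conjTranspose)).sub
      ((((hΦ y hy).matrix_mul (hasDerivAt_const y J)).matrix_mul
        (hΦ y hy).matrix_conjTranspose).const_smul Complex.I)).congr_deriv ?_
    simp only [Matrix.conjTranspose_neg, Matrix.conjTranspose_smul, Complex.star_def,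
      Complex.conj_I, Matrix.conjTranspose_mul, hJ, hH y hy, Matrix.mul_zero, add_zero,
      Matrix.mul_add, Matrix.add_mul, Matrix.mul_sub, Matrix.sub_mul,
      Matrix.neg_mul, Matrix.mul_smul, Matrix.smul_mul, Matrix.mul_assoc, smul_add, smul_neg,
      neg_smul, neg_neg, smul_smul, Complex.I_mul_I, one_smul]
    abel
  have h := hI.eq_of_hasDerivAt_zero h0 hx hξ
  simp only [hid, sub_self] at h
  exact sub_eq_zero.1 h

theorem hasDerivAt_darboux {J H : Matrix (Fin m) (Fin m) ℂ} (hJ : Jᴴ = J) (hH : Hᴴ = H)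
    {A : Matrix (Fin n) (Fin n) ℂ} {S R : ℝ → Matrix (Fin n) (Fin n) ℂ}
    {Φ : ℝ → Matrix (Fin n) (Fin m) ℂ} {c : ℂ}
    (hΦ : HasDerivAt Φ (-(Complex.I • (A * Φ x * J * H))) x)
    (hS : HasDerivAt S (Φ x * J * H * Jᴴ * (Φ x)ᴴ - (A * S x + S x * Aᴴ)) x)
    (hSu : IsUnit (S x))
    (hid : A * S x - S x * Aᴴ = Complex.I • (Φ x * J * (Φ x)ᴴ))
    (hR : HasDerivAt R (-1 - (2 * c) • R x) x)
    (hRA : R x * A = 1 + c • R x) (hAR : A * R x = 1 + c • R x)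
    {V : Matrix (Fin m) (Fin n) ℂ} (hV : V = J * (Φ x)ᴴ * (S x)⁻¹)
    {w : Matrix (Fin m) (Fin m) ℂ} (hw : w = 1 - Complex.I • (V * R x * Φ x)) :
    HasDerivAt (fun t => 1 - Complex.I • (J * (Φ t)ᴴ * (S t)⁻¹ * R t * Φ t))
      ((J * H * V * Φ x - V * Φ x * J * H - Complex.I • (V * Φ x)) * w +
        (Complex.I * c) • (J * H * w - w * (J * H))) x := by
  have hdet := (Matrix.isUnit_iff_isUnit_det _).1 hSu
  have hAT : Aᴴ * (S x)⁻¹ =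
      (S x)⁻¹ * A - Complex.I • ((S x)⁻¹ * Φ x * V) := by
    have h := congrArg (fun M => (S x)⁻¹ * M * (S x)⁻¹) hid
    simp only [Matrix.mul_sub, Matrix.sub_mul, Matrix.nonsing_inv_mul_cancel_left _ _ hdet,
      Matrix.mul_nonsing_inv_cancel_right _ _ hdet, ← Matrix.mul_assoc] at h
    rw [eq_sub_iff_add_eq, ← eq_sub_iff_add_eq', h, hV]
    simp only [Matrix.mul_smul, Matrix.smul_mul, Matrix.mul_assoc]
  have hV' : HasDerivAt (fun t => J * (Φ t)ᴴ * (S t)⁻¹)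
      (Complex.I • (J * H * V * A) + J * H * V * Φ x * V - V * Φ x * J * H * V +
        (2 : ℂ) • (V * A) - Complex.I • (V * Φ x * V)) x := by
    refine ((((hasDerivAt_const x J).matrix_mul hΦ.matrix_conjTranspose)).matrix_mul
      (hS.matrix_inv hSu)).congr_deriv ?_
    have e1 : J * (Φ x)ᴴ * Aᴴ * (S x)⁻¹ = V * A - Complex.I • (V * Φ x * V) := by
      rw [Matrix.mul_assoc _ Aᴴ, hAT, Matrix.mul_sub, ← Matrix.mul_assoc, ← hV, Matrix.mul_smul,
        hV]
      simp only [Matrix.mul_assoc]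
    have e2 : J * (Φ x)ᴴ * ((S x)⁻¹ * (Φ x * J * H * Jᴴ * (Φ x)ᴴ - (A * S x + S x * Aᴴ)) *
        (S x)⁻¹) = V * Φ x * J * H * V - V * A - J * (Φ x)ᴴ * Aᴴ * (S x)⁻¹ := by
      simp only [Matrix.mul_sub, Matrix.sub_mul, Matrix.mul_add, Matrix.add_mul, hV, hJ,
        Matrix.mul_assoc, Matrix.mul_nonsing_inv _ hdet, Matrix.mul_one,
        Matrix.nonsing_inv_mul_cancel_left _ _ hdet]
      abel
    have e3 : J * (-(Complex.I • (A * Φ x * J * H)))ᴴ * (S x)⁻¹ =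
        Complex.I • (J * H * (J * (Φ x)ᴴ * Aᴴ * (S x)⁻¹)) := by
      simp only [Matrix.conjTranspose_neg, Matrix.conjTranspose_smul, Complex.star_def,
        Complex.conj_I, Matrix.conjTranspose_mul, hJ, hH, Matrix.mul_smul, Matrix.smul_mul,
        neg_smul, neg_neg, Matrix.mul_assoc]
    rw [Matrix.zero_mul, zero_add, Matrix.mul_neg, e2, e3, e1]
    simp only [Matrix.mul_sub, Matrix.mul_smul, smul_sub, smul_smul, Complex.I_mul_I,
      Matrix.mul_assoc]
    module
  refine (hasDerivAt_const x (1 : Matrix (Fin m) (Fin m) ℂ)).sub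
    (((hV'.matrix_mul hR).matrix_mul hΦ).const_smul Complex.I) |>.congr_deriv ?_
  have r1 : ∀ M : Matrix (Fin n) (Fin m) ℂ, A * (R x * M) = M + c • (R x * M) := fun M => by
    rw [← Matrix.mul_assoc, hAR, Matrix.add_mul, Matrix.one_mul, Matrix.smul_mul]
  have r2 : ∀ M : Matrix (Fin n) (Fin m) ℂ, R x * (A * M) = M + c • (R x * M) := fun M => by
    rw [← Matrix.mul_assoc, hRA, Matrix.add_mul, Matrix.one_mul, Matrix.smul_mul]
  rw [← hV, hw]
  simp only [Matrix.mul_add, Matrix.add_mul, Matrix.mul_sub, Matrix.sub_mul, Matrix.mul_neg,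
    Matrix.neg_mul, Matrix.mul_smul, Matrix.smul_mul, Matrix.mul_assoc, Matrix.mul_one,
    Matrix.one_mul, r1, r2]
  match_scalars <;>
    first
      | ring1
      | linear_combination Complex.I_sq
      | linear_combination -Complex.I_sq

theorem darboux_isometry {J : Matrix (Fin m) (Fin m) ℂ} (hJ : Jᴴ = J) (hJJ : J * J = 1)
    {A C S : Matrix (Fin n) (Fin n) ℂ} {Φ : Matrix (Fin n) (Fin m) ℂ} (hSh : Sᴴ = S)
    (hSu : IsUnit S) (hid : A * S - S * Aᴴ = Complex.I • (Φ * J * Φᴴ)) (hAC : A * C = 1)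
    {w : Matrix (Fin m) (Fin m) ℂ} (hw : w = 1 - Complex.I • (J * Φᴴ * S⁻¹ * C * Φ)) :
    J * wᴴ * J * w = 1 := by
  have hdet := (Matrix.isUnit_iff_isUnit_det _).1 hSu
  have hCA : Cᴴ * Aᴴ = 1 := by rw [← Matrix.conjTranspose_mul, hAC, Matrix.conjTranspose_one]
  have hTh : (S⁻¹)ᴴ = S⁻¹ := by rw [Matrix.conjTranspose_nonsing_inv, hSh]
  have key : Complex.I • (Cᴴ * S⁻¹ * (Φ * J * Φᴴ) * S⁻¹ * C) = Cᴴ * S⁻¹ - S⁻¹ * C := by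
    have h : Complex.I • (Cᴴ * S⁻¹ * (Φ * J * Φᴴ) * S⁻¹ * C) =
        Cᴴ * S⁻¹ * (A * S - S * Aᴴ) * S⁻¹ * C := by
      rw [hid]; simp only [Matrix.mul_smul, Matrix.smul_mul]
    rw [h]
    simp only [Matrix.mul_sub, Matrix.sub_mul, Matrix.mul_assoc,
      Matrix.mul_nonsing_inv_cancel_left _ _ hdet, Matrix.nonsing_inv_mul_cancel_left _ _ hdet, hAC]
    rw [Matrix.mul_one, ← Matrix.mul_assoc Cᴴ Aᴴ, hCA, Matrix.one_mul]
  have key2 := congrArg (fun M => J * (Φᴴ * (M * Φ))) key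
  simp only [Matrix.mul_sub, Matrix.sub_mul, Matrix.mul_smul, Matrix.smul_mul,
    Matrix.mul_assoc] at key2
  rw [hw]
  simp only [Matrix.conjTranspose_sub, Matrix.conjTranspose_one, Matrix.conjTranspose_smul,
    Complex.star_def, Complex.conj_I, Matrix.conjTranspose_mul, Matrix.conjTranspose_conjTranspose,
    hJ, hTh, Matrix.mul_sub, Matrix.mul_smul, Matrix.smul_mul, Matrix.mul_assoc,
    Matrix.mul_one, Matrix.one_mul, hJJ, neg_smul, sub_neg_eq_add, Matrix.mul_add,
    Matrix.add_mul]
  rw [key2]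
  module

end Transform

/-- the main GBDT theorem (Theorem 2.1): `w̃ = v(·,z) W` solves the
transformed non-isospectral canonical system with Hamiltonian `H̃ = w₀* H w₀`. -/
theorem stmt_5 {m n : ℕ} (I : Set ℝ) (hI : I.OrdConnected)
    (J : Matrix (Fin m) (Fin m) ℂ) (hJherm : Jᴴ = J) (hJinv : J * J = 1)
    (H : ℝ → Matrix (Fin m) (Fin m) ℂ) (hHcont : ContinuousOn H I)
    (hHpos : ∀ x ∈ I, (H x).PosSemidef)
    (B : Matrix (Fin n) (Fin n) ℂ)
    (hB : ∀ x ∈ I, IsUnit (B - (x : ℂ) • (1 : Matrix (Fin n) (Fin n) ℂ)))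
    (Φ : ℝ → Matrix (Fin n) (Fin m) ℂ) (S : ℝ → Matrix (Fin n) (Fin n) ℂ)
    (hΦ : ∀ x ∈ I, HasDerivAt Φ (-(Complex.I • (Amat B x * Φ x * J * H x))) x)
    (hS : ∀ x ∈ I, HasDerivAt S
      (Φ x * J * H x * Jᴴ * (Φ x)ᴴ - (Amat B x * S x + S x * (Amat B x)ᴴ)) x)
    (ξ : ℝ) (hξ : ξ ∈ I) (hSξ : S ξ = (S ξ)ᴴ)
    (hid : Amat B ξ * S ξ - S ξ * (Amat B ξ)ᴴ = Complex.I • (Φ ξ * J * (Φ ξ)ᴴ))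
    (hSinv : ∀ x ∈ I, IsUnit (S x))
    (z : ℂ) (hz : ∀ x ∈ I, z ≠ (x : ℂ))
    (hBz : IsUnit (B - z • (1 : Matrix (Fin n) (Fin n) ℂ)))
    (hBzbar : IsUnit (B - (starRingEnd ℂ z) • (1 : Matrix (Fin n) (Fin n) ℂ)))
    (W : ℝ → Matrix (Fin m) (Fin m) ℂ)
    (hW : ∀ x ∈ I, HasDerivAt W
      ((Complex.I * (z - (x : ℂ))⁻¹) • (J * H x * W x)) x) :
    ∀ x ∈ I, HasDerivAt (fun t : ℝ => vfun J B S Φ z t * W t)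
      ((Complex.I * (z - (x : ℂ))⁻¹) •
        (J * ((w0fun J B S Φ x)ᴴ * H x * w0fun J B S Φ x) *
          (vfun J B S Φ z x * W x))) x := by
  intro x hx
  have hH : ∀ y ∈ I, (H y)ᴴ = H y := fun y hy => (hHpos y hy).isHermitian
  have hA : ∀ y ∈ I, HasDerivAt (Amat B) (Amat B y * Amat B y) y :=
    fun y hy => hasDerivAt_Amat (hB y hy)
  have hAu : ∀ y ∈ I, IsUnit (Amat B y) := fun y hy => isUnit_nonsing_inv_iff.2 (hB y hy)
  have hSh : (S x)ᴴ = S x := by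
    refine isHermitian_of_hasDerivAt hI hA hAu (fun y hy => ?_) hS hξ hSξ hx
    simp only [conjTranspose_mul, conjTranspose_conjTranspose, hJherm, hH y hy, Matrix.mul_assoc]
  have hidx := operator_identity_of_hasDerivAt hI hJherm hH hA hΦ hS hξ hid hx
  have hAdet := (isUnit_iff_isUnit_det _).1 (hAu x hx)
  have hzx : z - (x : ℂ) ≠ 0 := sub_ne_zero.2 (hz x hx)
  set μ : ℂ := (z - (x : ℂ))⁻¹ with hμ
  have hμ' : HasDerivAt (fun t : ℝ => (z - (t : ℂ))⁻¹) (μ * μ) x := by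
    refine ((Complex.ofRealCLM.hasDerivAt (x := x)).const_sub z).inv hzx |>.congr_deriv ?_
    simp [hμ, pow_two, div_eq_mul_inv]
  have hCA : (B - (x : ℂ) • (1 : Matrix (Fin n) (Fin n) ℂ)) * Amat B x = 1 :=
    mul_nonsing_inv _ ((isUnit_iff_isUnit_det _).1 (hB x hx))
  have hMu : IsUnit (Amat B x - μ • (1 : Matrix (Fin n) (Fin n) ℂ)) := by
    have e : Amat B x - μ • (1 : Matrix (Fin n) (Fin n) ℂ) =
        (-μ) • ((B - z • (1 : Matrix (Fin n) (Fin n) ℂ)) * Amat B x) := by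
      have e1 : B - z • (1 : Matrix (Fin n) (Fin n) ℂ) =
          (B - (x : ℂ) • (1 : Matrix (Fin n) (Fin n) ℂ)) - (z - (x : ℂ)) • 1 := by module
      rw [e1, Matrix.sub_mul, hCA, Matrix.smul_mul, Matrix.one_mul, smul_sub, smul_smul, neg_mul,
        hμ, inv_mul_cancel₀ hzx]
      module
    rw [e]
    exact (hBz.mul (hAu x hx)).smul (Units.mk0 (-μ) (neg_ne_zero.2 (inv_ne_zero hzx)))
  have hMdet := (isUnit_iff_isUnit_det _).1 hMu
  have hw := hasDerivAt_darboux hJherm (hH x hx) (hΦ x hx) (hS x hx) (hSinv x hx) hidx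
    (hasDerivAt_resolvent (hA x hx) hμ' hMu)
    (by
      have h := nonsing_inv_mul _ hMdet
      rw [Matrix.mul_sub, Matrix.mul_smul, Matrix.mul_one] at h
      exact sub_eq_iff_eq_add.1 h)
    (by
      have h := mul_nonsing_inv _ hMdet
      rw [Matrix.sub_mul, Matrix.smul_mul, Matrix.one_mul] at h
      exact sub_eq_iff_eq_add.1 h) rfl rfl
  have hw0 := hasDerivAt_darboux (c := 0) hJherm (hH x hx) (hΦ x hx) (hS x hx) (hSinv x hx) hidx
    ((((hA x hx).matrix_inv (hAu x hx))).congr_deriv (by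
      rw [nonsing_inv_mul_cancel_left _ _ hAdet, mul_nonsing_inv _ hAdet, mul_zero, zero_smul,
        sub_zero]))
    (by rw [nonsing_inv_mul _ hAdet, zero_smul, add_zero])
    (by rw [mul_nonsing_inv _ hAdet, zero_smul, add_zero]) rfl rfl
  have hiso := darboux_isometry hJherm hJinv hSh (hSinv x hx) hidx (mul_nonsing_inv _ hAdet) rfl
  rw [mul_zero, zero_smul, add_zero] at hw0
  obtain ⟨Q, hw, hw0⟩ : ∃ Q, HasDerivAt (wAfun J B S Φ z) (Q * wAfun J B S Φ z x +
      (Complex.I * μ) • (J * H x * wAfun J B S Φ z x - wAfun J B S Φ z x * (J * H x))) x ∧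
      HasDerivAt (w0fun J B S Φ) (Q * w0fun J B S Φ x) x := ⟨_, hw, hw0⟩
  change J * (w0fun J B S Φ x)ᴴ * J * w0fun J B S Φ x = 1 at hiso
  have hw0u : IsUnit (w0fun J B S Φ x) := IsUnit.of_mul_eq_one_right _ hiso
  have hw0det := (isUnit_iff_isUnit_det _).1 hw0u
  have hinv : (w0fun J B S Φ x)⁻¹ = J * (w0fun J B S Φ x)ᴴ * J := inv_eq_left_inv hiso
  have hinvJ : (w0fun J B S Φ x)⁻¹ * J = J * (w0fun J B S Φ x)ᴴ := by
    rw [hinv, Matrix.mul_assoc, hJinv, Matrix.mul_one]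
  refine (((hw0.matrix_inv hw0u).matrix_mul hw).matrix_mul (hW x hx)).congr_deriv ?_
  have hgoal : J * ((w0fun J B S Φ x)ᴴ * H x * w0fun J B S Φ x) * (vfun J B S Φ z x * W x) =
      (w0fun J B S Φ x)⁻¹ * (J * (H x * (wAfun J B S Φ z x * W x))) := by
    rw [← Matrix.mul_assoc _ J, hinvJ, vfun]
    simp only [Matrix.mul_assoc, mul_nonsing_inv_cancel_left _ _ hw0det]
  rw [hgoal]
  simp only [Matrix.mul_add, Matrix.add_mul, Matrix.mul_sub, Matrix.sub_mul, Matrix.mul_smul,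
    Matrix.smul_mul, Matrix.neg_mul, Matrix.mul_assoc, mul_nonsing_inv_cancel_left _ _ hw0det]
  module
end

section
/- Let B = diag{b_1, …, b_n} ∈ ℂ^{n×n} be diagonal with b_i ≠ b̄_j for all i, j, let x ∈ ℝ be such that B − x I_n is invertible, set A = (B − x I_n)^{−1}, and let J ∈ ℂ^{m×m} with J = J* and Π ∈ ℂ^{n×m}. Define the n×n matrix S entrywise by S_{ij} = ((b_i − x)(b̄_j − x) / (i (b_i − b̄_j))) · (Π J Π*)_{ij}. Then A S − S A* = i Π J Π* and S = S*. -/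
open Matrix

theorem diagonal_sub_smul_one {n R : Type*} [DecidableEq n] [Ring R] (b : n → R) (x : R) :
    Matrix.diagonal b - x • (1 : Matrix n n R) = Matrix.diagonal fun i => b i - x := by
  rw [Matrix.smul_one_eq_diagonal, Matrix.diagonal_sub]

/-- the explicit solution (5.12) of the Lyapunov-type identity
`A S − S A* = i Π J Π*` for `A = (B − x Iₙ)⁻¹` with diagonal `B`. -/
theorem stmt_6 {m n : ℕ} (b : Fin n → ℂ)
    (hb : ∀ i j, b i ≠ starRingEnd ℂ (b j)) (x : ℝ)
    (hBx : IsUnit (Matrix.diagonal b - (x : ℂ) • (1 : Matrix (Fin n) (Fin n) ℂ)))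
    (J : Matrix (Fin m) (Fin m) ℂ) (hJherm : Jᴴ = J)
    (Φ : Matrix (Fin n) (Fin m) ℂ) :
    (Matrix.diagonal b - (x : ℂ) • (1 : Matrix (Fin n) (Fin n) ℂ))⁻¹ *
        (Matrix.of fun i j : Fin n =>
          (b i - (x : ℂ)) * (starRingEnd ℂ (b j) - (x : ℂ)) /
            (Complex.I * (b i - starRingEnd ℂ (b j))) * (Φ * J * Φᴴ) i j) -
      (Matrix.of fun i j : Fin n =>
          (b i - (x : ℂ)) * (starRingEnd ℂ (b j) - (x : ℂ)) /
            (Complex.I * (b i - starRingEnd ℂ (b j))) * (Φ * J * Φᴴ) i j) *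
        ((Matrix.diagonal b - (x : ℂ) • (1 : Matrix (Fin n) (Fin n) ℂ))⁻¹)ᴴ =
      Complex.I • (Φ * J * Φᴴ)
    ∧ (Matrix.of fun i j : Fin n =>
          (b i - (x : ℂ)) * (starRingEnd ℂ (b j) - (x : ℂ)) /
            (Complex.I * (b i - starRingEnd ℂ (b j))) * (Φ * J * Φᴴ) i j) =
        (Matrix.of fun i j : Fin n =>
          (b i - (x : ℂ)) * (starRingEnd ℂ (b j) - (x : ℂ)) /
            (Complex.I * (b i - starRingEnd ℂ (b j))) * (Φ * J * Φᴴ) i j)ᴴ := by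
  have hne : ∀ i, b i - (x : ℂ) ≠ 0 := by
    rw [diagonal_sub_smul_one] at hBx
    exact fun i => (Pi.isUnit_iff.mp (Matrix.isUnit_diagonal.mp hBx) i).ne_zero
  have hinv : (Matrix.diagonal b - (x : ℂ) • (1 : Matrix (Fin n) (Fin n) ℂ))⁻¹ =
      Matrix.diagonal fun i => (b i - (x : ℂ))⁻¹ := by
    refine Matrix.inv_eq_right_inv ?_
    rw [diagonal_sub_smul_one, Matrix.diagonal_mul_diagonal, ← Matrix.diagonal_one]
    congr 1
    funext i
    exact mul_inv_cancel₀ (hne i)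
  have hne' : ∀ i, starRingEnd ℂ (b i) - (x : ℂ) ≠ 0 := fun i h =>
    hne i (by simpa using congrArg (starRingEnd ℂ) h)
  have hsub : ∀ i j, b i - starRingEnd ℂ (b j) ≠ 0 := fun i j => sub_ne_zero.mpr (hb i j)
  have hherm : (Φ * J * Φᴴ).IsHermitian :=
    Matrix.isHermitian_mul_mul_conjTranspose Φ hJherm
  refine ⟨?_, ?_⟩
  · rw [hinv, Matrix.diagonal_conjTranspose]
    ext i j
    rw [Matrix.sub_apply, Matrix.diagonal_mul, Matrix.mul_diagonal, Matrix.smul_apply,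
      smul_eq_mul]
    have hi := hne i
    have hj := hne' j
    have hij := hsub i j
    simp only [Matrix.of_apply, Pi.star_apply, ← starRingEnd_apply, map_inv₀, map_sub,
      Complex.conj_ofReal]
    generalize (Φ * J * Φᴴ) i j = p
    generalize starRingEnd ℂ (b j) = c at *
    field_simp
    rw [Complex.I_sq]
    ring
  · ext i j
    rw [Matrix.conjTranspose_apply, Matrix.of_apply, Matrix.of_apply, star_mul',
      hherm.apply i j]
    congr 1
    simp only [← starRingEnd_apply, map_div₀, map_mul, map_sub, Complex.conj_ofReal,
      Complex.conj_conj, Complex.conj_I]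
    congr 1 <;> ring
end

section
/- Let J ∈ ℂ^{m×m} with J = J* = J^{−1}, let β : [a,b] → ℂ^{k×m} be continuous, set H(x) = β(x)*β(x), and assume there is M > 0 with ‖(x−t)^{−1} β(x) J β(t)*‖ ≤ M for all a ≤ t < x ≤ b. For z ∉ ℝ let W(x,z) be the fundamental solution of w_x = i(z−x)^{−1} J H(x) w with W(a,z) = I_m. Then for all a ≤ s ≤ x ≤ b the limit V(x,s) := lim_{η→0+} (W(x, s+iη) − W(x, s−iη)) exists, and there is M₁ > 0 with ‖V(x,s)‖ ≤ M₁ for all a ≤ s ≤ x ≤ b. -/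
open Matrix

attribute [local instance] Matrix.normedAddCommGroup Matrix.normedSpace

section

open Set Filter Topology MeasureTheory

/-- Integral form of Grönwall's inequality. -/
theorem le_mul_exp_of_le_add_integral {g : ℝ → ℝ} {a b B M : ℝ} (hM : 0 ≤ M)
    (hg : ContinuousOn g (Icc a b))
    (h : ∀ t ∈ Icc a b, g t ≤ B + M * ∫ τ in a..t, g τ) :
    ∀ t ∈ Icc a b, g t ≤ B * Real.exp (M * (t - a)) := by
  intro t ht
  have hab : a ≤ b := ht.1.trans ht.2
  set φ : ℝ → ℝ := fun t => (B + M * ∫ τ in a..t, g τ) * Real.exp (-(M * (t - a))) with hφ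
  have hderiv : ∀ x ∈ Ioo a b, HasDerivAt φ
      ((M * g x) * Real.exp (-(M * (x - a))) +
        (B + M * ∫ τ in a..x, g τ) * (Real.exp (-(M * (x - a))) * (-(M * 1)))) x := by
    intro x hx
    have h1 : HasDerivAt (fun t => ∫ τ in a..t, g τ) (g x) x := by
      apply intervalIntegral.integral_hasDerivAt_right
      · exact (hg.mono (Icc_subset_Icc le_rfl hx.2.le)).intervalIntegrable_of_Icc hx.1.le
      · exact (hg.mono Ioo_subset_Icc_self).stronglyMeasurableAtFilter isOpen_Ioo x hx
      · exact hg.continuousAt (Icc_mem_nhds hx.1 hx.2)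
    exact ((h1.const_mul M).const_add B).mul
      ((((hasDerivAt_id x).sub_const a).const_mul M).neg.exp)
  have hanti : AntitoneOn φ (Icc a b) := by
    apply antitoneOn_of_deriv_nonpos (convex_Icc a b)
    · have : ContinuousOn (fun t => ∫ τ in a..t, g τ) (Icc a b) := by
        have := intervalIntegral.continuousOn_primitive_interval
          (f := g) (μ := volume) (a := a) (b := b)
          (by rw [uIcc_of_le hab]; exact hg.integrableOn_Icc)
        rwa [uIcc_of_le hab] at this
      fun_prop
    · rw [interior_Icc]
      exact fun x hx => (hderiv x hx).differentiableAt.differentiableWithinAt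
    · rw [interior_Icc]
      intro x hx
      rw [(hderiv x hx).deriv]
      have := mul_nonneg (mul_nonneg hM (sub_nonneg.2 (h x (Ioo_subset_Icc_self hx))))
        (Real.exp_pos (-(M * (x - a)))).le
      nlinarith
  have h1 : φ t ≤ φ a := hanti (left_mem_Icc.2 hab) ht ht.1
  have h2 : φ a = B := by simp [hφ]
  rw [h2] at h1
  refine (h t ht).trans ?_
  have h3 : B + M * ∫ τ in a..t, g τ = φ t * Real.exp (M * (t - a)) := by
    simp only [hφ]; rw [mul_assoc, ← Real.exp_add]; simp
  rw [h3]
  exact mul_le_mul_of_nonneg_right h1 (Real.exp_pos _).le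

/-- The Cauchy kernel `1 / (s + ih - τ)` on the real line. -/
noncomputable def cauchyKer (s h τ : ℝ) : ℂ := ((s : ℂ) + (h : ℂ) * Complex.I - (τ : ℂ))⁻¹

theorem cauchyKer_den_ne_zero {s h : ℝ} (hh : h ≠ 0) (τ : ℝ) :
    (s : ℂ) + (h : ℂ) * Complex.I - (τ : ℂ) ≠ 0 := by
  intro h0
  apply hh
  simpa using congrArg Complex.im h0

theorem norm_cauchyKer (s h τ : ℝ) : ‖cauchyKer s h τ‖ = (√((τ - s) ^ 2 + h ^ 2))⁻¹ := by
  rw [cauchyKer, norm_inv, Complex.norm_eq_sqrt_sq_add_sq]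
  congr 2
  simp
  ring

theorem continuous_cauchyKer {s h : ℝ} (hh : h ≠ 0) : Continuous (cauchyKer s h) := by
  unfold cauchyKer
  exact Continuous.inv₀ (by fun_prop) (cauchyKer_den_ne_zero hh)

theorem abs_sub_mul_norm_cauchyKer_le (s h τ : ℝ) : |τ - s| * ‖cauchyKer s h τ‖ ≤ 1 := by
  rw [norm_cauchyKer, ← div_eq_mul_inv]
  apply div_le_one_of_le₀ _ (Real.sqrt_nonneg _)
  apply Real.le_sqrt_of_sq_le
  rw [sq_abs]; nlinarith [sq_nonneg h]

theorem abs_mul_norm_cauchyKer_le (s h τ : ℝ) : |h| * ‖cauchyKer s h τ‖ ≤ 1 := by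
  rw [norm_cauchyKer, ← div_eq_mul_inv]
  apply div_le_one_of_le₀ _ (Real.sqrt_nonneg _)
  apply Real.le_sqrt_of_sq_le
  rw [sq_abs]; nlinarith [sq_nonneg (τ - s)]

theorem norm_cauchyKer_sub {s h h' : ℝ} (hh : h ≠ 0) (hh' : h' ≠ 0) (τ : ℝ) :
    ‖cauchyKer s h τ - cauchyKer s h' τ‖ =
      |h - h'| * ‖cauchyKer s h τ‖ * ‖cauchyKer s h' τ‖ := by
  have h1 := cauchyKer_den_ne_zero (s := s) hh τ
  have h2 := cauchyKer_den_ne_zero (s := s) hh' τ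
  have : cauchyKer s h τ - cauchyKer s h' τ =
      -(((h - h' : ℝ) : ℂ) * Complex.I) * cauchyKer s h τ * cauchyKer s h' τ := by
    unfold cauchyKer
    rw [inv_sub_inv h1 h2, div_eq_mul_inv, mul_inv]
    push_cast; ring
  rw [this, norm_mul, norm_mul, norm_neg, norm_mul, Complex.norm_I, mul_one,
    Complex.norm_real, Real.norm_eq_abs]

theorem arsinh_le_two_mul_sqrt {x : ℝ} (hx : 0 ≤ x) : Real.arsinh x ≤ 2 * √(1 + 2 * x) := by
  have h1 : √(1 + x ^ 2) ≤ 1 + x := Real.sqrt_le_iff.2 ⟨by linarith, by nlinarith⟩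
  have h0 : 0 < x + √(1 + x ^ 2) := by positivity
  have h2 : 0 < √(1 + 2 * x) := by positivity
  calc Real.arsinh x = Real.log (x + √(1 + x ^ 2)) := rfl
    _ ≤ Real.log (1 + 2 * x) := Real.log_le_log h0 (by linarith)
    _ = 2 * Real.log √(1 + 2 * x) := by rw [Real.log_sqrt (by linarith)]; ring
    _ ≤ 2 * √(1 + 2 * x) := by
      have := Real.log_le_sub_one_of_pos h2
      linarith

theorem integral_norm_cauchyKer_le {a b s h Λ : ℝ} (hs : s ∈ Icc a b) (hΛ : b - a ≤ Λ)
    (hh : 0 < |h|) (hh1 : |h| ≤ 1) :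
    ∫ τ in a..b, ‖cauchyKer s h τ‖ ≤ 4 * √(1 + 2 * Λ) / √|h| := by
  have hd : ∀ τ ∈ uIcc a b, HasDerivAt (fun τ => Real.arsinh ((τ - s) / |h|))
      ‖cauchyKer s h τ‖ τ := by
    intro τ _
    have := (((hasDerivAt_id τ).sub_const s).div_const |h|).arsinh
    refine this.congr_deriv ?_
    rw [norm_cauchyKer]
    simp only [id, smul_eq_mul, one_div]
    rw [← mul_inv]
    congr 1
    rw [← Real.sqrt_sq hh.le, ← Real.sqrt_mul (by positivity), Real.sqrt_sq hh.le]
    congr 1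
    rw [← sq_abs h]
    field_simp
    ring
  have hne : h ≠ 0 := abs_pos.1 hh
  rw [intervalIntegral.integral_eq_sub_of_hasDerivAt hd
    ((continuous_cauchyKer hne).norm.intervalIntegrable _ _)]
  have key : ∀ r, 0 ≤ r → r ≤ Λ → Real.arsinh (r / |h|) ≤ 2 * √(1 + 2 * Λ) / √|h| := by
    intro r hr hr'
    refine (arsinh_le_two_mul_sqrt (by positivity)).trans ?_
    rw [mul_div_assoc, ← Real.sqrt_div (by linarith)]
    gcongr
    rw [le_div_iff₀ hh]
    have : (1 + 2 * (r / |h|)) * |h| = |h| + 2 * r := by field_simp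
    linarith
  have e : Real.arsinh ((a - s) / |h|) = - Real.arsinh ((s - a) / |h|) := by
    rw [← Real.arsinh_neg]; congr 1; ring
  rw [e]
  have := key (b - s) (by linarith [hs.2]) (by linarith [hs.1])
  have := key (s - a) (by linarith [hs.1]) (by linarith [hs.2])
  have e2 : 4 * √(1 + 2 * Λ) / √|h| = 2 * √(1 + 2 * Λ) / √|h| + 2 * √(1 + 2 * Λ) / √|h| := by ring
  linarith

/-- A family `u η`, `η > 0`, of solutions of the Volterra equations
`u(t) = f(t) + ∫ₐᵗ K(t,τ) u(τ) / (s + iση - τ) dτ`, whose kernel `K` vanishes on the diagonal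
at a Lipschitz rate. -/
structure IsSingularVolterra {U : Type*} [NormedAddCommGroup U] [NormedSpace ℂ U]
    (a b s σ B M : ℝ) (f : ℝ → U) (K : ℝ → ℝ → U →L[ℂ] U) (u : ℝ → ℝ → U) : Prop where
  mem : s ∈ Icc a b
  abs_sign : |σ| = 1
  bound_nonneg : 0 ≤ B
  rate_nonneg : 0 ≤ M
  continuousOn_data : ContinuousOn f (Icc a b)
  norm_data_le : ∀ t ∈ Icc a b, ‖f t‖ ≤ B
  continuousOn_right : ∀ t ∈ Icc a b, ContinuousOn (fun τ => K t τ) (Icc a b)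
  continuousOn_left : ∀ τ ∈ Icc a b, ContinuousOn (fun t => K t τ) (Icc a b)
  norm_kernel_le : ∀ t ∈ Icc a b, ∀ τ ∈ Icc a b, ‖K t τ‖ ≤ M * |t - τ|
  continuousOn_sol : ∀ η, 0 < η → ContinuousOn (u η) (Icc a b)
  eqn : ∀ η, 0 < η → ∀ t ∈ Icc a b,
    u η t = f t + ∫ τ in a..t, cauchyKer s (σ * η) τ • K t τ (u η τ)

namespace IsSingularVolterra

variable {U : Type*} [NormedAddCommGroup U] [NormedSpace ℂ U]
  {a b s σ B M : ℝ} {f : ℝ → U} {K : ℝ → ℝ → U →L[ℂ] U} {u : ℝ → ℝ → U}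

theorem sign_mul_ne_zero (H : IsSingularVolterra a b s σ B M f K u) {η : ℝ} (hη : 0 < η) :
    σ * η ≠ 0 := by
  have : σ ≠ 0 := by
    rintro h; have := H.abs_sign; simp [h] at this
  exact mul_ne_zero this hη.ne'

theorem abs_sign_mul (H : IsSingularVolterra a b s σ B M f K u) {η : ℝ} (hη : 0 < η) :
    |σ * η| = η := by
  rw [abs_mul, H.abs_sign, one_mul, abs_of_pos hη]

theorem continuousOn_integrand (H : IsSingularVolterra a b s σ B M f K u) {η η' : ℝ} (hη : 0 < η)
    (hη' : 0 < η') {t : ℝ} (ht : t ∈ Icc a b) :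
    ContinuousOn (fun τ => cauchyKer s (σ * η) τ • K t τ (u η' τ)) (Icc a b) :=
  (continuous_cauchyKer (H.sign_mul_ne_zero hη)).continuousOn.smul
    ((H.continuousOn_right t ht).clm_apply (H.continuousOn_sol η' hη'))

theorem norm_sol_le (H : IsSingularVolterra a b s σ B M f K u) {η : ℝ} (hη : 0 < η)
    {t : ℝ} (ht : t ∈ Icc a b) :
    ‖u η t‖ ≤ B + ∫ τ in a..t, M * (t - τ) * (‖cauchyKer s (σ * η) τ‖ * ‖u η τ‖) := by
  rw [H.eqn η hη t ht]
  refine (norm_add_le _ _).trans (add_le_add (H.norm_data_le t ht) ?_)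
  have hsub : Icc a t ⊆ Icc a b := Icc_subset_Icc le_rfl ht.2
  refine intervalIntegral.norm_integral_le_of_norm_le ht.1 ?_ ?_
  · refine ae_of_all _ fun τ hτ => ?_
    have hτ' : τ ∈ Icc a b := ⟨hτ.1.le, hτ.2.trans ht.2⟩
    rw [norm_smul]
    calc ‖cauchyKer s (σ * η) τ‖ * ‖K t τ (u η τ)‖
        ≤ ‖cauchyKer s (σ * η) τ‖ * (M * |t - τ| * ‖u η τ‖) := by
          gcongr
          exact (K t τ).le_of_opNorm_le (H.norm_kernel_le t ht τ hτ') _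
      _ = _ := by rw [abs_of_nonneg (sub_nonneg.2 hτ.2)]; ring
  · apply ContinuousOn.intervalIntegrable_of_Icc ht.1
    have h1 := (continuous_cauchyKer (s := s) (H.sign_mul_ne_zero hη)).norm.continuousOn (s := Icc a t)
    have h2 := ((H.continuousOn_sol η hη).mono hsub).norm
    fun_prop

theorem norm_sol_le_of_le (H : IsSingularVolterra a b s σ B M f K u) {η : ℝ} (hη : 0 < η)
    {t : ℝ} (ht : t ∈ Icc a s) :
    ‖u η t‖ ≤ B * Real.exp (M * (t - a)) := by
  have hsub : Icc a s ⊆ Icc a b := Icc_subset_Icc le_rfl H.mem.2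
  have hcu := ((H.continuousOn_sol η hη).mono hsub).norm
  refine le_mul_exp_of_le_add_integral H.rate_nonneg hcu (fun t ht => ?_) t ht
  refine (H.norm_sol_le hη (hsub ht)).trans ?_
  rw [← intervalIntegral.integral_const_mul]
  gcongr
  have hsub' : Icc a t ⊆ Icc a s := Icc_subset_Icc le_rfl ht.2
  have h2 := hcu.mono hsub'
  apply intervalIntegral.integral_mono_on ht.1
  · apply ContinuousOn.intervalIntegrable_of_Icc ht.1
    have h1 := (continuous_cauchyKer (s := s) (H.sign_mul_ne_zero hη)).norm.continuousOn (s := Icc a t)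
    fun_prop
  · apply ContinuousOn.intervalIntegrable_of_Icc ht.1
    fun_prop
  · intro τ hτ
    have h3 := abs_sub_mul_norm_cauchyKer_le s (σ * η) τ
    rw [abs_sub_comm, abs_of_nonneg (by linarith [hτ.2, ht.2])] at h3
    have h4 : (t - τ) * ‖cauchyKer s (σ * η) τ‖ ≤ 1 :=
      (mul_le_mul_of_nonneg_right (by linarith [ht.2]) (norm_nonneg _)).trans h3
    calc M * (t - τ) * (‖cauchyKer s (σ * η) τ‖ * ‖u η τ‖)
        = M * (((t - τ) * ‖cauchyKer s (σ * η) τ‖) * ‖u η τ‖) := by ring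
      _ ≤ M * (1 * ‖u η τ‖) := by
        have := H.rate_nonneg
        gcongr
      _ = _ := by ring

/-- A constant bounding the solutions up to the singularity, for intervals of length `≤ Λ`. -/
noncomputable def baseConst (B M Λ : ℝ) : ℝ := B + M * (Λ * (B * Real.exp (M * Λ)))

/-- A constant bounding the solutions on the whole interval, for intervals of length `≤ Λ`. -/
noncomputable def growthConst (B M Λ : ℝ) : ℝ :=
  baseConst B M Λ + M * (baseConst B M Λ * (4 * √(1 + 2 * Λ)) * Real.exp (M * Λ))

theorem baseConst_nonneg (H : IsSingularVolterra a b s σ B M f K u) {Λ : ℝ} (hΛ : b - a ≤ Λ) :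
    0 ≤ baseConst B M Λ := by
  have h1 := H.bound_nonneg
  have h2 := H.rate_nonneg
  have h3 : 0 ≤ Λ := by linarith [H.mem.1, H.mem.2]
  unfold baseConst; positivity

theorem baseConst_le_growthConst (H : IsSingularVolterra a b s σ B M f K u) {Λ : ℝ}
    (hΛ : b - a ≤ Λ) : baseConst B M Λ ≤ growthConst B M Λ := by
  have h1 := H.baseConst_nonneg hΛ
  have h2 := H.rate_nonneg
  unfold growthConst
  have : 0 ≤ M * (baseConst B M Λ * (4 * √(1 + 2 * Λ)) * Real.exp (M * Λ)) := by positivity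
  linarith

theorem norm_sol_le_exp (H : IsSingularVolterra a b s σ B M f K u) {Λ : ℝ} (hΛ : b - a ≤ Λ)
    {η : ℝ} (hη : 0 < η) {t : ℝ} (ht : t ∈ Icc a s) : ‖u η t‖ ≤ B * Real.exp (M * Λ) := by
  refine (H.norm_sol_le_of_le hη ht).trans ?_
  have h1 := H.bound_nonneg
  have h2 := H.rate_nonneg
  gcongr
  linarith [ht.2, H.mem.2]

theorem norm_sol_le_add (H : IsSingularVolterra a b s σ B M f K u) {Λ : ℝ} (hΛ : b - a ≤ Λ)
    {η : ℝ} (hη : 0 < η) {t : ℝ} (ht : t ∈ Icc a b) :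
    ‖u η t‖ ≤ baseConst B M Λ +
      M * (max (t - s) 0 * ∫ τ in a..t, ‖cauchyKer s (σ * η) τ‖ * ‖u η τ‖) := by
  have hB := H.bound_nonneg
  have hM := H.rate_nonneg
  have hΛ0 : 0 ≤ Λ := by linarith [H.mem.1, H.mem.2]
  have hsub : Icc a t ⊆ Icc a b := Icc_subset_Icc le_rfl ht.2
  refine (H.norm_sol_le hη ht).trans ?_
  have h1 := (continuous_cauchyKer (s := s) (H.sign_mul_ne_zero hη)).norm.continuousOn
    (s := Icc a t)
  have h2 := ((H.continuousOn_sol η hη).mono hsub).norm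
  set E := B * Real.exp (M * Λ) with hE
  have hE0 : 0 ≤ E := by positivity
  have key : ∫ τ in a..t, M * (t - τ) * (‖cauchyKer s (σ * η) τ‖ * ‖u η τ‖) ≤
      ∫ τ in a..t, (M * E + M * max (t - s) 0 * (‖cauchyKer s (σ * η) τ‖ * ‖u η τ‖)) := by
    apply intervalIntegral.integral_mono_on ht.1
    · apply ContinuousOn.intervalIntegrable_of_Icc ht.1
      fun_prop
    · apply ContinuousOn.intervalIntegrable_of_Icc ht.1
      fun_prop
    · intro τ hτ
      have hc := norm_nonneg (cauchyKer s (σ * η) τ)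
      have hu := norm_nonneg (u η τ)
      have hmax := le_max_left (t - s) 0
      have hmax0 := le_max_right (t - s) 0
      rcases le_total τ s with hτs | hτs
      · have h3 := abs_sub_mul_norm_cauchyKer_le s (σ * η) τ
        rw [abs_sub_comm, abs_of_nonneg (by linarith)] at h3
        have h5 : ‖u η τ‖ ≤ E := H.norm_sol_le_exp hΛ hη ⟨hτ.1, hτs⟩
        calc M * (t - τ) * (‖cauchyKer s (σ * η) τ‖ * ‖u η τ‖)
            = M * (((s - τ) * ‖cauchyKer s (σ * η) τ‖) * ‖u η τ‖) +
              M * (t - s) * (‖cauchyKer s (σ * η) τ‖ * ‖u η τ‖) := by ring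
          _ ≤ M * (1 * E) + M * max (t - s) 0 * (‖cauchyKer s (σ * η) τ‖ * ‖u η τ‖) := by
            gcongr
          _ = _ := by ring
      · have : t - τ ≤ max (t - s) 0 := by linarith
        have h6 : 0 ≤ M * E := by positivity
        calc M * (t - τ) * (‖cauchyKer s (σ * η) τ‖ * ‖u η τ‖)
            ≤ M * max (t - s) 0 * (‖cauchyKer s (σ * η) τ‖ * ‖u η τ‖) := by gcongr
          _ ≤ _ := by linarith
  have e : ∫ τ in a..t, (M * E + M * max (t - s) 0 * (‖cauchyKer s (σ * η) τ‖ * ‖u η τ‖)) =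
      (t - a) * (M * E) +
        M * max (t - s) 0 * ∫ τ in a..t, (‖cauchyKer s (σ * η) τ‖ * ‖u η τ‖) := by
    rw [intervalIntegral.integral_add, intervalIntegral.integral_const,
      intervalIntegral.integral_const_mul, smul_eq_mul]
    · exact intervalIntegrable_const
    · apply ContinuousOn.intervalIntegrable_of_Icc ht.1
      fun_prop
  rw [e] at key
  have h7 : (t - a) * (M * E) ≤ Λ * (M * E) := by
    gcongr; linarith [ht.2]
  unfold baseConst
  rw [← hE]
  linarith

theorem integral_norm_mul_norm_sol_le (H : IsSingularVolterra a b s σ B M f K u) {Λ : ℝ}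
    (hΛ : b - a ≤ Λ) {η : ℝ} (hη : 0 < η) (hη1 : η ≤ 1) {t : ℝ} (ht : t ∈ Icc a b) :
    ∫ τ in a..t, ‖cauchyKer s (σ * η) τ‖ * ‖u η τ‖ ≤
      baseConst B M Λ * (4 * √(1 + 2 * Λ) / √η) * Real.exp (M * Λ) := by
  have hM := H.rate_nonneg
  have hab := H.mem.1.trans H.mem.2
  have hC := H.baseConst_nonneg hΛ
  set N : ℝ → ℝ := fun t => ∫ τ in a..t, ‖cauchyKer s (σ * η) τ‖ * ‖u η τ‖ with hN
  have hc := (continuous_cauchyKer (s := s) (H.sign_mul_ne_zero hη)).norm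
  have hcI := hc.continuousOn (s := Icc a b)
  have hu := (H.continuousOn_sol η hη).norm
  have hNc : ContinuousOn N (Icc a b) := by
    have := intervalIntegral.continuousOn_primitive_interval
      (f := fun τ => ‖cauchyKer s (σ * η) τ‖ * ‖u η τ‖) (μ := volume) (a := a) (b := b)
      (by rw [uIcc_of_le hab]; exact (hcI.mul hu).integrableOn_Icc)
    rwa [uIcc_of_le hab] at this
  have hN0 : ∀ t ∈ Icc a b, 0 ≤ N t := fun t ht =>
    intervalIntegral.integral_nonneg ht.1 fun τ _ => by positivity
  have hL := integral_norm_cauchyKer_le H.mem hΛ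
    (by rw [H.abs_sign_mul hη]; exact hη) (by rw [H.abs_sign_mul hη]; exact hη1)
  rw [H.abs_sign_mul hη] at hL
  have main : ∀ t ∈ Icc a b, N t ≤
      baseConst B M Λ * (4 * √(1 + 2 * Λ) / √η) + M * ∫ τ in a..t, N τ := by
    intro t ht
    have hsub : Icc a t ⊆ Icc a b := Icc_subset_Icc le_rfl ht.2
    have hNt := hNc.mono hsub
    have hut := hu.mono hsub
    have hct := hcI.mono hsub
    have h1 : N t ≤ ∫ τ in a..t, (baseConst B M Λ * ‖cauchyKer s (σ * η) τ‖ + M * N τ) := by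
      apply intervalIntegral.integral_mono_on ht.1
      · apply ContinuousOn.intervalIntegrable_of_Icc ht.1
        fun_prop
      · apply ContinuousOn.intervalIntegrable_of_Icc ht.1
        fun_prop
      · intro τ hτ
        have h2 := H.norm_sol_le_add hΛ hη (hsub hτ)
        have h3 : max (τ - s) 0 * ‖cauchyKer s (σ * η) τ‖ ≤ 1 := by
          refine le_trans ?_ (abs_sub_mul_norm_cauchyKer_le s (σ * η) τ)
          gcongr
          exact max_le (le_abs_self _) (abs_nonneg _)
        have h4 := hN0 τ (hsub hτ)
        calc ‖cauchyKer s (σ * η) τ‖ * ‖u η τ‖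
            ≤ ‖cauchyKer s (σ * η) τ‖ * (baseConst B M Λ + M * (max (τ - s) 0 * N τ)) := by
              gcongr
          _ = baseConst B M Λ * ‖cauchyKer s (σ * η) τ‖ +
              M * ((max (τ - s) 0 * ‖cauchyKer s (σ * η) τ‖) * N τ) := by ring
          _ ≤ baseConst B M Λ * ‖cauchyKer s (σ * η) τ‖ + M * (1 * N τ) := by gcongr
          _ = _ := by ring
    rw [intervalIntegral.integral_add, intervalIntegral.integral_const_mul,
      intervalIntegral.integral_const_mul] at h1
    · refine h1.trans ?_
      gcongr
      refine le_trans ?_ hL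
      exact intervalIntegral.integral_mono_interval le_rfl ht.1 ht.2
        (ae_of_all _ fun _ => norm_nonneg _) (hc.intervalIntegrable _ _)
    · apply ContinuousOn.intervalIntegrable_of_Icc ht.1
      fun_prop
    · apply ContinuousOn.intervalIntegrable_of_Icc ht.1
      fun_prop
  refine (le_mul_exp_of_le_add_integral hM hNc main t ht).trans ?_
  gcongr
  linarith [ht.2]

theorem norm_sol_le_growthConst (H : IsSingularVolterra a b s σ B M f K u) {Λ : ℝ}
    (hΛ : b - a ≤ Λ) {η : ℝ} (hη : 0 < η) (hη1 : η ≤ 1) {t : ℝ} (ht : t ∈ Icc a b) :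
    ‖u η t‖ ≤ growthConst B M Λ * (1 + max (t - s) 0 / √η) := by
  have hM := H.rate_nonneg
  have hC := H.baseConst_nonneg hΛ
  have h1 := H.norm_sol_le_add hΛ hη ht
  have h2 := H.integral_norm_mul_norm_sol_le hΛ hη hη1 ht
  have h0 := le_max_right (t - s) 0
  have h3 := mul_le_mul_of_nonneg_left (mul_le_mul_of_nonneg_left h2 h0) hM
  have h4 := H.baseConst_le_growthConst hΛ
  have h5 : 0 ≤ max (t - s) 0 / √η := by positivity
  have h6 : M * (baseConst B M Λ * (4 * √(1 + 2 * Λ)) * Real.exp (M * Λ)) ≤ growthConst B M Λ := by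
    unfold growthConst; linarith
  calc ‖u η t‖ ≤ baseConst B M Λ + (M * (baseConst B M Λ * (4 * √(1 + 2 * Λ)) * Real.exp (M * Λ)))
        * (max (t - s) 0 / √η) := by
        refine h1.trans ?_
        refine (add_le_add_right h3 _).trans (le_of_eq ?_)
        ring
    _ ≤ growthConst B M Λ + growthConst B M Λ * (max (t - s) 0 / √η) := by gcongr
    _ = _ := by ring

/-- Up to the singularity, the solutions are uniformly Cauchy as `η → 0`. -/
theorem norm_sol_sub_le (H : IsSingularVolterra a b s σ B M f K u) {Λ : ℝ}
    (hΛ : b - a ≤ Λ) {η η' : ℝ} (hη' : 0 < η') (hle : η' ≤ η) (hη1 : η ≤ 1)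
    {t : ℝ} (ht : t ∈ Icc a s) :
    ‖u η t - u η' t‖ ≤
      M * (B * Real.exp (M * Λ)) * (4 * √(1 + 2 * Λ)) * √η * Real.exp (M * (t - a)) := by
  have hη : 0 < η := hη'.trans_le hle
  have hB := H.bound_nonneg
  have hM := H.rate_nonneg
  have hsub : Icc a s ⊆ Icc a b := Icc_subset_Icc le_rfl H.mem.2
  have hcd : ContinuousOn (fun t => u η t - u η' t) (Icc a s) :=
    ((H.continuousOn_sol η hη).sub (H.continuousOn_sol η' hη')).mono hsub
  refine le_mul_exp_of_le_add_integral hM hcd.norm (fun t ht => ?_) t ht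
  have htb := hsub ht
  have hsubt : Icc a t ⊆ Icc a b := Icc_subset_Icc le_rfl htb.2
  set E := B * Real.exp (M * Λ) with hE
  have hE0 : 0 ≤ E := by positivity
  have hI : ∀ {η η'}, 0 < η → 0 < η' → IntervalIntegrable
      (fun τ => cauchyKer s (σ * η) τ • K t τ (u η' τ)) volume a t := fun hη hη' =>
    ((H.continuousOn_integrand hη hη' htb).mono hsubt).intervalIntegrable_of_Icc ht.1
  have hdiff : u η t - u η' t = ∫ τ in a..t,
      (cauchyKer s (σ * η) τ • K t τ (u η τ - u η' τ) +
        (cauchyKer s (σ * η) τ - cauchyKer s (σ * η') τ) • K t τ (u η' τ)) := by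
    rw [H.eqn η hη t htb, H.eqn η' hη' t htb, add_sub_add_left_eq_sub,
      ← intervalIntegral.integral_sub (hI hη hη) (hI hη' hη')]
    congr 1
    ext τ
    rw [map_sub, smul_sub, sub_smul]
    abel
  rw [hdiff]
  have hc := (continuous_cauchyKer (s := s) (H.sign_mul_ne_zero hη)).norm
  have hct := hc.continuousOn (s := Icc a t)
  have hdt := (hcd.mono (Icc_subset_Icc le_rfl ht.2 : Icc a t ⊆ Icc a s)).norm
  have hbound : ‖∫ τ in a..t,
      (cauchyKer s (σ * η) τ • K t τ (u η τ - u η' τ) +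
        (cauchyKer s (σ * η) τ - cauchyKer s (σ * η') τ) • K t τ (u η' τ))‖ ≤
      ∫ τ in a..t, (M * ‖u η τ - u η' τ‖ + M * E * η * ‖cauchyKer s (σ * η) τ‖) := by
    apply intervalIntegral.norm_integral_le_of_norm_le ht.1
    · refine ae_of_all _ fun τ hτ => ?_
      have hτ' : τ ∈ Icc a b := ⟨hτ.1.le, hτ.2.trans htb.2⟩
      have hker := H.norm_kernel_le t htb τ hτ'
      have hker' : ∀ h, ‖cauchyKer s h τ‖ * ‖K t τ‖ ≤ M := by
        intro h
        have h3 := abs_sub_mul_norm_cauchyKer_le s h τ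
        have h4 : |t - τ| ≤ |τ - s| := by
          rw [abs_of_nonneg (by linarith [hτ.2]), abs_of_nonpos (by linarith [hτ.2, ht.2])]
          linarith [ht.2]
        calc ‖cauchyKer s h τ‖ * ‖K t τ‖ ≤ ‖cauchyKer s h τ‖ * (M * |τ - s|) := by
              gcongr; exact hker.trans (by gcongr)
          _ = M * (|τ - s| * ‖cauchyKer s h τ‖) := by ring
          _ ≤ M * 1 := by gcongr
          _ = M := mul_one M
      refine (norm_add_le _ _).trans (add_le_add ?_ ?_)
      · rw [norm_smul]
        calc _ ≤ ‖cauchyKer s (σ * η) τ‖ * (‖K t τ‖ * ‖u η τ - u η' τ‖) := by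
              gcongr; exact (K t τ).le_opNorm _
          _ = (‖cauchyKer s (σ * η) τ‖ * ‖K t τ‖) * ‖u η τ - u η' τ‖ := by ring
          _ ≤ _ := by gcongr; exact hker' _
      · rw [norm_smul, norm_cauchyKer_sub (H.sign_mul_ne_zero hη) (H.sign_mul_ne_zero hη')]
        have h5 : |σ * η - σ * η'| ≤ η := by
          rw [← mul_sub, abs_mul, H.abs_sign, one_mul, abs_of_nonneg (by linarith)]
          linarith
        have h6 : ‖u η' τ‖ ≤ E := H.norm_sol_le_exp hΛ hη' ⟨hτ.1.le, hτ.2.trans ht.2⟩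
        calc _ ≤ (η * ‖cauchyKer s (σ * η) τ‖ * ‖cauchyKer s (σ * η') τ‖) * (‖K t τ‖ * E) := by
              gcongr
              exact (K t τ).le_opNorm_of_le h6
          _ = (‖cauchyKer s (σ * η') τ‖ * ‖K t τ‖) * (E * η * ‖cauchyKer s (σ * η) τ‖) := by ring
          _ ≤ M * (E * η * ‖cauchyKer s (σ * η) τ‖) := by gcongr; exact hker' _
          _ = _ := by ring
    · apply ContinuousOn.intervalIntegrable_of_Icc ht.1
      fun_prop
  refine hbound.trans ?_
  rw [intervalIntegral.integral_add, intervalIntegral.integral_const_mul,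
      intervalIntegral.integral_const_mul, add_comm]
  · refine add_le_add ?_ le_rfl
    have hL := integral_norm_cauchyKer_le H.mem hΛ
      (by rw [H.abs_sign_mul hη]; exact hη) (by rw [H.abs_sign_mul hη]; exact hη1)
    rw [H.abs_sign_mul hη] at hL
    have h7 : ∫ τ in a..t, ‖cauchyKer s (σ * η) τ‖ ≤ 4 * √(1 + 2 * Λ) / √η := by
      refine le_trans ?_ hL
      exact intervalIntegral.integral_mono_interval le_rfl ht.1 htb.2
        (ae_of_all _ fun _ => norm_nonneg _) (hc.intervalIntegrable _ _)
    calc M * E * η * ∫ τ in a..t, ‖cauchyKer s (σ * η) τ‖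
        ≤ M * E * η * (4 * √(1 + 2 * Λ) / √η) := by gcongr
      _ = M * E * (4 * √(1 + 2 * Λ)) * (η / √η) := by ring
      _ = _ := by rw [Real.div_sqrt]
  · apply ContinuousOn.intervalIntegrable_of_Icc ht.1
    fun_prop
  · apply ContinuousOn.intervalIntegrable_of_Icc ht.1
    fun_prop

theorem exists_tendsto_sol_singularity [CompleteSpace U] (H : IsSingularVolterra a b s σ B M f K u) :
    ∃ u₀, Tendsto (fun η => u η s) (𝓝[>] 0) (𝓝 u₀) := by
  have hB := H.bound_nonneg
  have hM := H.rate_nonneg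
  set C := M * (B * Real.exp (M * (b - a))) * (4 * √(1 + 2 * (b - a))) with hC
  set D := Real.exp (M * (s - a)) with hD
  have hlim : Tendsto (fun η : ℝ => C * √η * D) (𝓝[>] 0) (𝓝 0) := by
    have : Continuous fun η : ℝ => C * √η * D := by fun_prop
    have h := (this.tendsto 0).mono_left (nhdsWithin_le_nhds (s := Ioi 0))
    simpa using h
  have hcauchy : Cauchy (map (fun η => u η s) (𝓝[>] 0)) := by
    rw [Metric.cauchy_iff]
    refine ⟨inferInstance, fun ε hε => ?_⟩
    have hev : ∀ᶠ η in 𝓝[>] (0 : ℝ), (C * √η * D < ε ∧ 0 < η) ∧ η ≤ 1 :=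
      ((hlim.eventually_lt_const hε).and self_mem_nhdsWithin).and
        (nhdsWithin_le_nhds (Iic_mem_nhds one_pos))
    refine ⟨_, image_mem_map hev, ?_⟩
    have key : ∀ η η', ((C * √η * D < ε ∧ 0 < η) ∧ η ≤ 1) → 0 < η' → η' ≤ η →
        ‖u η s - u η' s‖ < ε := fun η η' h h0 hle =>
      (H.norm_sol_sub_le le_rfl h0 hle h.2 (right_mem_Icc.2 H.mem.1)).trans_lt h.1.1
    rintro _ ⟨η, hη, rfl⟩ _ ⟨η', hη', rfl⟩
    rcases le_total η' η with h | h
    · rw [dist_eq_norm]; exact key η η' hη hη'.1.2 h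
    · rw [dist_comm, dist_eq_norm]; exact key η' η hη' hη.1.2 h
  exact cauchy_map_iff_exists_tendsto.1 hcauchy

theorem tendsto_sol_sub (H : IsSingularVolterra a b s σ B M f K u) {y : ℝ}
    (hy : ∀ᶠ η in 𝓝[>] (0 : ℝ), s + η * y ∈ Icc a b) :
    Tendsto (fun η => u η (s + η * y) - u η s) (𝓝[>] 0) (𝓝 0) := by
  have hB := H.bound_nonneg
  have hM := H.rate_nonneg
  have hs := H.mem
  have hpt : Tendsto (fun η : ℝ => s + η * y) (𝓝[>] 0) (𝓝[Icc a b] s) := by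
    refine tendsto_nhdsWithin_iff.2 ⟨?_, hy⟩
    have : Continuous fun η : ℝ => s + η * y := by fun_prop
    have h := (this.tendsto 0).mono_left (nhdsWithin_le_nhds (s := Ioi 0))
    simpa using h
  have hpos : ∀ᶠ η in 𝓝[>] (0 : ℝ), 0 < η := self_mem_nhdsWithin
  have hone : ∀ᶠ η in 𝓝[>] (0 : ℝ), η ≤ 1 := nhdsWithin_le_nhds (Iic_mem_nhds one_pos)
  set E := B * Real.exp (M * (b - a)) with hE
  have hE0 : 0 ≤ E := by positivity
  have h1 : Tendsto (fun η : ℝ => f (s + η * y) - f s) (𝓝[>] 0) (𝓝 0) := by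
    have := ((H.continuousOn_data s hs).tendsto.comp hpt).sub_const (f s)
    simpa using this
  have h2 : Tendsto (fun η : ℝ => ∫ τ in a..s,
      cauchyKer s (σ * η) τ • (K (s + η * y) τ - K s τ) (u η τ)) (𝓝[>] 0) (𝓝 0) := by
    have : (0 : U) = ∫ τ in a..s, (0 : U) := by simp
    rw [this]
    apply intervalIntegral.tendsto_integral_filter_of_dominated_convergence
      (fun _ => M * (|y| + 2) * E)
    · filter_upwards [hpos, hy] with η hη hyη
      rw [uIoc_of_le hs.1]
      have hsub : Ioc a s ⊆ Icc a b := fun τ hτ => ⟨hτ.1.le, hτ.2.trans hs.2⟩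
      refine ContinuousOn.aestronglyMeasurable ?_ measurableSet_Ioc
      exact ((H.continuousOn_integrand hη hη hyη).sub (H.continuousOn_integrand hη hη hs)).mono hsub
        |>.congr fun τ _ => by simp [smul_sub]
    · filter_upwards [hpos, hy] with η hη hyη
      refine ae_of_all _ fun τ hτ => ?_
      rw [uIoc_of_le hs.1] at hτ
      have hτb : τ ∈ Icc a b := ⟨hτ.1.le, hτ.2.trans hs.2⟩
      have hu : ‖u η τ‖ ≤ E := H.norm_sol_le_exp le_rfl hη ⟨hτ.1.le, hτ.2⟩
      have hk1 := H.norm_kernel_le _ hyη τ hτb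
      have hk2 := H.norm_kernel_le s hs τ hτb
      have hc1 := abs_sub_mul_norm_cauchyKer_le s (σ * η) τ
      have hc2 := abs_mul_norm_cauchyKer_le s (σ * η) τ
      rw [H.abs_sign_mul hη] at hc2
      have htri : |s + η * y - τ| ≤ η * |y| + |τ - s| := by
        have := abs_add_le (η * y) (s - τ)
        rw [abs_mul, abs_of_pos hη, abs_sub_comm s τ] at this
        rwa [show s + η * y - τ = η * y + (s - τ) by ring]
      rw [norm_smul]
      calc _ ≤ ‖cauchyKer s (σ * η) τ‖ *
            ((M * (η * |y| + |τ - s|) + M * |τ - s|) * E) := by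
            gcongr
            refine ContinuousLinearMap.le_of_opNorm_le_of_le _ ?_ hu
            refine (norm_sub_le _ _).trans (add_le_add (hk1.trans (by gcongr)) ?_)
            rwa [abs_sub_comm τ s]
        _ = M * ((η * ‖cauchyKer s (σ * η) τ‖) * |y| +
            2 * (|τ - s| * ‖cauchyKer s (σ * η) τ‖)) * E := by ring
        _ ≤ M * (1 * |y| + 2 * 1) * E := by gcongr
        _ = _ := by ring
    · exact intervalIntegrable_const
    · have hne : ∀ᵐ τ : ℝ, τ ≠ s := by simp [ae_iff]
      filter_upwards [hne] with τ hτs hτ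
      rw [uIoc_of_le hs.1] at hτ
      have hτb : τ ∈ Icc a b := ⟨hτ.1.le, hτ.2.trans hs.2⟩
      have hk : Tendsto (fun η : ℝ => |τ - s|⁻¹ * (‖K (s + η * y) τ - K s τ‖ * E))
          (𝓝[>] 0) (𝓝 0) := by
        have := ((H.continuousOn_left τ hτb s hs).tendsto.comp hpt).sub_const (K s τ)
        have := ((this.norm).mul_const E).const_mul (|τ - s|⁻¹)
        simpa using this
      refine squeeze_zero_norm' ?_ hk
      filter_upwards [hpos, hy] with η hη hyη
      have hu : ‖u η τ‖ ≤ E := H.norm_sol_le_exp le_rfl hη ⟨hτ.1.le, hτ.2⟩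
      have habs : 0 < |τ - s| := abs_pos.2 (sub_ne_zero.2 hτs)
      rw [norm_smul]
      gcongr
      · rw [← one_div, le_div_iff₀ habs, mul_comm]
        exact abs_sub_mul_norm_cauchyKer_le _ _ _
      · exact ContinuousLinearMap.le_opNorm_of_le _ hu
  have h3 : Tendsto (fun η : ℝ => ∫ τ in s..(s + η * y),
      cauchyKer s (σ * η) τ • K (s + η * y) τ (u η τ)) (𝓝[>] 0) (𝓝 0) := by
    set G := growthConst B M (b - a) with hG
    have hG0 : 0 ≤ G := (H.baseConst_nonneg le_rfl).trans (H.baseConst_le_growthConst le_rfl)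
    have hlim : Tendsto (fun η : ℝ => M * |y| * (G * (1 + |y|)) * |s + η * y - s|)
        (𝓝[>] 0) (𝓝 0) := by
      have : Continuous fun η : ℝ => M * |y| * (G * (1 + |y|)) * |s + η * y - s| := by fun_prop
      have h := (this.tendsto 0).mono_left (nhdsWithin_le_nhds (s := Ioi 0))
      simpa using h
    refine squeeze_zero_norm' ?_ hlim
    filter_upwards [hpos, hone, hy] with η hη hη1 hyη
    apply intervalIntegral.norm_integral_le_of_norm_le_const
    intro τ hτ
    have hτ' := uIoc_subset_uIcc hτ
    have hτb : τ ∈ Icc a b := (uIcc_subset_Icc hs hyη) hτ'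
    have hd1 : |s + η * y - τ| ≤ η * |y| := by
      have := abs_sub_right_of_mem_uIcc hτ'
      rw [add_sub_cancel_left, abs_mul, abs_of_pos hη] at this
      exact this
    have hd2 : |τ - s| ≤ η * |y| := by
      have := abs_sub_left_of_mem_uIcc hτ'
      rw [add_sub_cancel_left, abs_mul, abs_of_pos hη] at this
      exact this
    have hc2 := abs_mul_norm_cauchyKer_le s (σ * η) τ
    rw [H.abs_sign_mul hη] at hc2
    have hu : ‖u η τ‖ ≤ G * (1 + |y|) := by
      refine (H.norm_sol_le_growthConst le_rfl hη hη1 hτb).trans ?_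
      have : max (τ - s) 0 / √η ≤ |y| := by
        rw [div_le_iff₀ (Real.sqrt_pos.2 hη)]
        have h4 : η ≤ √η := Real.le_sqrt_of_sq_le (by nlinarith)
        calc max (τ - s) 0 ≤ |τ - s| := max_le (le_abs_self _) (abs_nonneg _)
          _ ≤ η * |y| := hd2
          _ ≤ √η * |y| := by gcongr
          _ = _ := mul_comm _ _
      gcongr
    rw [norm_smul]
    calc _ ≤ ‖cauchyKer s (σ * η) τ‖ * ((M * (η * |y|)) * (G * (1 + |y|))) := by
          gcongr
          exact ContinuousLinearMap.le_of_opNorm_le_of_le _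
            ((H.norm_kernel_le _ hyη τ hτb).trans (by gcongr)) hu
      _ = (η * ‖cauchyKer s (σ * η) τ‖) * (M * |y| * (G * (1 + |y|))) := by ring
      _ ≤ 1 * (M * |y| * (G * (1 + |y|))) := by gcongr
      _ = _ := one_mul _
  have h := (h1.add h2).add h3
  simp only [add_zero] at h
  refine h.congr' ?_
  filter_upwards [hpos, hy] with η hη hyη
  have hI : ∀ {t p q : ℝ}, t ∈ Icc a b → p ∈ Icc a b → q ∈ Icc a b → IntervalIntegrable
      (fun τ => cauchyKer s (σ * η) τ • K t τ (u η τ)) volume p q := fun ht hp hq =>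
    ((H.continuousOn_integrand hη hη ht).mono (uIcc_subset_Icc hp hq)).intervalIntegrable
  have ha : a ∈ Icc a b := left_mem_Icc.2 (hs.1.trans hs.2)
  rw [H.eqn η hη _ hyη, H.eqn η hη _ hs,
    ← intervalIntegral.integral_add_adjacent_intervals (hI hyη ha hs) (hI hyη hs hyη)]
  simp only [_root_.sub_apply, smul_sub]
  rw [intervalIntegral.integral_sub (hI hyη ha hs) (hI hs ha hs)]
  abel

/-- The solutions converge at scale `η` around the singularity. -/
theorem exists_tendsto_sol [CompleteSpace U] (H : IsSingularVolterra a b s σ B M f K u) :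
    ∃ u₀, ∀ y : ℝ, (∀ᶠ η in 𝓝[>] (0 : ℝ), s + η * y ∈ Icc a b) →
      Tendsto (fun η => u η (s + η * y)) (𝓝[>] 0) (𝓝 u₀) := by
  obtain ⟨u₀, hu₀⟩ := H.exists_tendsto_sol_singularity
  refine ⟨u₀, fun y hy => ?_⟩
  simpa using (H.tendsto_sol_sub hy).add hu₀

end IsSingularVolterra

theorem one_add_sqrt_abs_div_le (L y : ℝ) (hL : 0 ≤ L) :
    2 / (1 + y ^ 2) * (1 + L * √|y|) ≤ 4 * (1 + L) * (1 + ‖y‖) ^ (-(3 / 2) : ℝ) := by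
  rw [Real.norm_eq_abs]
  have h0 := abs_nonneg y
  set r := 1 + |y| with hr
  have hr0 : 0 < r := by positivity
  have h1 : √|y| ≤ √r := Real.sqrt_le_sqrt (by linarith)
  have h2 : 1 ≤ √r := Real.one_le_sqrt.2 (by linarith)
  have h3 : r ^ (-(3 / 2) : ℝ) = √r / r ^ 2 := by
    rw [Real.sqrt_eq_rpow, ← Real.rpow_natCast r 2, ← Real.rpow_sub hr0]
    norm_num
  have h4 : r ^ 2 ≤ 2 * (1 + y ^ 2) := by
    rw [hr, ← sq_abs y]; nlinarith [sq_nonneg (1 - |y|)]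
  have h5 : 2 / (1 + y ^ 2) ≤ 4 / r ^ 2 := by
    rw [div_le_div_iff₀ (by positivity) (by positivity)]; linarith
  calc 2 / (1 + y ^ 2) * (1 + L * √|y|) ≤ 4 / r ^ 2 * (√r + L * √r) := by gcongr
    _ = _ := by rw [h3]; ring

/-- Poisson integrals of a family that converges at scale `η` around the pole and grows
moderately away from it converge, with a uniform bound. -/
theorem exists_tendsto_integral_poisson {U : Type*} [NormedAddCommGroup U] [NormedSpace ℝ U]
    [CompleteSpace U] {a b s Λ C : ℝ} (hs : s ∈ Icc a b) (hΛ : b - a ≤ Λ) (hC : 0 ≤ C)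
    {G : ℝ → ℝ → U} (hGc : ∀ η, 0 < η → ContinuousOn (G η) (Icc a b))
    (hG : ∀ η, 0 < η → η ≤ 1 → ∀ t ∈ Icc a b, ‖G η t‖ ≤ C * (1 + |t - s| / √η))
    {G₀ : U} (hlim : ∀ y : ℝ, (∀ᶠ η in 𝓝[>] (0 : ℝ), s + η * y ∈ Icc a b) →
      Tendsto (fun η => G η (s + η * y)) (𝓝[>] 0) (𝓝 G₀)) :
    ∃ V, Tendsto (fun η : ℝ => ∫ t in a..b, (2 * η / ((t - s) ^ 2 + η ^ 2)) • G η t)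
      (𝓝[>] 0) (𝓝 V) ∧
      ‖V‖ ≤ ∫ y : ℝ, C * (4 * (1 + √Λ) * (1 + ‖y‖) ^ (-(3 / 2) : ℝ)) := by
  classical
  have hab := hs.1.trans hs.2
  have hpos : ∀ᶠ η in 𝓝[>] (0 : ℝ), 0 < η := self_mem_nhdsWithin
  have hone : ∀ᶠ η in 𝓝[>] (0 : ℝ), η ≤ 1 := nhdsWithin_le_nhds (Iic_mem_nhds one_pos)
  set F : ℝ → ℝ → U := fun η y =>
    (Icc a b).indicator (fun t => (2 / (1 + y ^ 2)) • G η t) (s + η * y) with hF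
  have hint : Integrable (fun y : ℝ => C * (4 * (1 + √Λ) * (1 + ‖y‖) ^ (-(3 / 2) : ℝ))) :=
    ((integrable_one_add_norm (by norm_num)).const_mul _).const_mul _
  have hbound : ∀ η, 0 < η → η ≤ 1 → ∀ y, ‖F η y‖ ≤
      C * (4 * (1 + √Λ) * (1 + ‖y‖) ^ (-(3 / 2) : ℝ)) := by
    intro η hη hη1 y
    by_cases hy : s + η * y ∈ Icc a b
    · simp only [hF, indicator_of_mem hy]
      have habs : η * |y| ≤ Λ := by
        rw [show η * |y| = |η * y| by rw [abs_mul, abs_of_pos hη], abs_le]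
        constructor <;> linarith [hy.1, hy.2, hs.1, hs.2]
      have hq : |s + η * y - s| / √η ≤ √Λ * √|y| := by
        rw [add_sub_cancel_left, abs_mul, abs_of_pos hη]
        calc η * |y| / √η = (η / √η) * |y| := by ring
          _ = √η * (√|y| * √|y|) := by rw [Real.div_sqrt, Real.mul_self_sqrt (abs_nonneg y)]
          _ = √(η * |y|) * √|y| := by rw [Real.sqrt_mul hη.le]; ring
          _ ≤ _ := by gcongr
      rw [norm_smul, Real.norm_of_nonneg (by positivity)]
      calc 2 / (1 + y ^ 2) * ‖G η (s + η * y)‖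
          ≤ 2 / (1 + y ^ 2) * (C * (1 + √Λ * √|y|)) := by
            gcongr
            exact (hG η hη hη1 _ hy).trans (by gcongr)
        _ = C * (2 / (1 + y ^ 2) * (1 + √Λ * √|y|)) := by ring
        _ ≤ _ := mul_le_mul_of_nonneg_left
          (one_add_sqrt_abs_div_le _ _ (Real.sqrt_nonneg _)) hC
    · simp only [hF, indicator_of_notMem hy, norm_zero]
      positivity
  have hsubst : ∀ η, 0 < η →
      ∫ t in a..b, (2 * η / ((t - s) ^ 2 + η ^ 2)) • G η t = ∫ y, F η y := by
    intro η hη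
    rw [intervalIntegral.integral_of_le hab, ← integral_Icc_eq_integral_Ioc,
      ← integral_indicator measurableSet_Icc,
      ← integral_add_left_eq_self _ s]
    have h := Measure.integral_comp_mul_left (fun q => (Icc a b).indicator
      (fun t => (2 * η / ((t - s) ^ 2 + η ^ 2)) • G η t) (s + q)) η
    rw [eq_comm, abs_of_pos (inv_pos.2 hη), inv_smul_eq_iff₀ hη.ne', ← integral_smul] at h
    rw [h]
    congr 1
    ext y
    by_cases hy : s + η * y ∈ Icc a b
    · simp only [hF, indicator_of_mem hy, smul_smul]
      congr 1
      field_simp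
      ring
    · simp only [hF, indicator_of_notMem hy, smul_zero]
  set V := ∫ y : ℝ, if (∀ᶠ η in 𝓝[>] (0 : ℝ), s + η * y ∈ Icc a b)
    then (2 / (1 + y ^ 2)) • G₀ else 0 with hV
  have hmain : Tendsto (fun η => ∫ y, F η y) (𝓝[>] 0) (𝓝 V) := by
    apply tendsto_integral_filter_of_dominated_convergence _ _ _ hint
    · refine ae_of_all _ fun y => ?_
      split_ifs with hy
      · refine ((hlim y hy).const_smul (2 / (1 + y ^ 2))).congr' ?_
        filter_upwards [hy] with η hyη
        simp only [hF, indicator_of_mem hyη]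
      · have hnot : ∀ᶠ η in 𝓝[>] (0 : ℝ), s + η * y ∉ Icc a b := by
          by_contra hfreq
          apply hy
          rw [not_eventually] at hfreq
          obtain ⟨η₀, h1, h2⟩ := (hfreq.and_eventually hpos).exists
          rw [not_not] at h1
          filter_upwards [Ioo_mem_nhdsGT h2] with η hη
          have : s + η * y = (1 - η / η₀) * s + (η / η₀) * (s + η₀ * y) := by
            field_simp; ring
          have h3 : 0 ≤ 1 - η / η₀ := sub_nonneg.2 (div_le_one_of_le₀ hη.2.le h2.le)
          have h4 := convex_Icc a b hs h1 h3 (div_nonneg hη.1.le h2.le) (sub_add_cancel _ _)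
          rwa [smul_eq_mul, smul_eq_mul, ← this] at h4
        refine tendsto_const_nhds.congr' ?_
        filter_upwards [hnot] with η hyη
        simp only [hF, indicator_of_notMem hyη]
    · filter_upwards [hpos] with η hη
      have hmeas : MeasurableSet ((fun y : ℝ => s + η * y) ⁻¹' Icc a b) :=
        measurableSet_Icc.preimage (by fun_prop)
      have hcont : ContinuousOn (fun y : ℝ => (2 / (1 + y ^ 2)) • G η (s + η * y))
          ((fun y : ℝ => s + η * y) ⁻¹' Icc a b) := by
        refine ContinuousOn.smul ?_ ?_
        · refine Continuous.continuousOn (Continuous.div (by fun_prop) (by fun_prop) fun y => ?_)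
          positivity
        · exact (hGc η hη).comp (by fun_prop) fun y hy => hy
      exact (aestronglyMeasurable_indicator_iff hmeas).2 (hcont.aestronglyMeasurable hmeas)
    · filter_upwards [hpos, hone] with η hη hη1
      exact ae_of_all _ (hbound η hη hη1)
  refine ⟨V, hmain.congr' ?_, ?_⟩
  · filter_upwards [hpos] with η hη
    exact (hsubst η hη).symm
  · refine le_of_tendsto hmain.norm ?_
    filter_upwards [hpos, hone] with η hη hη1
    exact norm_integral_le_of_norm_le hint (ae_of_all _ (hbound η hη hη1))

/-- Volterra families whose kernel acts through a bounded bilinear map. -/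
theorem IsSingularVolterra.of_bilinear {E U : Type*} [NormedAddCommGroup E] [NormedSpace ℂ E]
    [NormedAddCommGroup U] [NormedSpace ℂ U] [CompleteSpace U] (T : E →ₗ[ℂ] U →ₗ[ℂ] U) {C : ℝ}
    (hC : 0 ≤ C)
    (hT : ∀ x y, ‖T x y‖ ≤ C * ‖x‖ * ‖y‖) {a b s σ B M : ℝ} (hs : s ∈ Icc a b) (hσ : |σ| = 1)
    (hB : 0 ≤ B) (hM : 0 ≤ M) {f : ℝ → U} (hf : ContinuousOn f (Icc a b))
    (hfB : ∀ t ∈ Icc a b, ‖f t‖ ≤ B) {κ : ℝ → ℝ → E}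
    (hκr : ∀ t ∈ Icc a b, ContinuousOn (fun τ => κ t τ) (Icc a b))
    (hκl : ∀ τ ∈ Icc a b, ContinuousOn (fun t => κ t τ) (Icc a b))
    (hκ : ∀ t ∈ Icc a b, ∀ τ ∈ Icc a b, ‖κ t τ‖ ≤ M * |t - τ|)
    {u : ℝ → ℝ → U} (hu : ∀ η, 0 < η → ContinuousOn (u η) (Icc a b))
    (hd : ∀ η, 0 < η → ∀ t ∈ Icc a b, ∃ g : ℝ → U, g a = f t ∧ g t = u η t ∧
      ∀ τ ∈ Icc a b, HasDerivAt g (cauchyKer s (σ * η) τ • T (κ t τ) (u η τ)) τ) :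
    IsSingularVolterra a b s σ B (C * M) f (fun t τ => T.mkContinuous₂ C hT (κ t τ)) u := by
  have hr : ∀ t ∈ Icc a b, ContinuousOn (fun τ => T.mkContinuous₂ C hT (κ t τ)) (Icc a b) :=
    fun t ht => (T.mkContinuous₂ C hT).continuous.comp_continuousOn (hκr t ht)
  have hσ0 : σ ≠ 0 := by
    rintro rfl; simp at hσ
  refine ⟨hs, hσ, hB, by positivity, hf, hfB, hr,
    fun τ hτ => (T.mkContinuous₂ C hT).continuous.comp_continuousOn (hκl τ hτ),
    fun t ht τ hτ => ?_, hu, fun η hη t ht => ?_⟩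
  · rw [mul_assoc]
    exact (ContinuousLinearMap.le_of_opNorm_le _ (T.mkContinuous₂_norm_le hC hT) _).trans
      (mul_le_mul_of_nonneg_left (hκ t ht τ hτ) hC)
  · obtain ⟨g, hga, hgt, hg⟩ := hd η hη t ht
    have hsub : uIcc a t ⊆ Icc a b := by
      rw [uIcc_of_le ht.1]; exact Icc_subset_Icc le_rfl ht.2
    have hcont : ContinuousOn (fun τ => cauchyKer s (σ * η) τ • T (κ t τ) (u η τ)) (uIcc a t) :=
      ((continuous_cauchyKer (mul_ne_zero hσ0 hη.ne')).continuousOn.smul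
        ((hr t ht).clm_apply (hu η hη))).mono hsub
    have h := intervalIntegral.integral_eq_sub_of_hasDerivAt (fun τ hτ => hg τ (hsub hτ))
      hcont.intervalIntegrable
    rw [hga, hgt] at h
    rw [← sub_eq_iff_eq_add']
    exact h.symm

theorem Matrix.norm_mul_le_card_mul {l p q : ℕ} (A : Matrix (Fin l) (Fin p) ℂ)
    (B : Matrix (Fin p) (Fin q) ℂ) : ‖A * B‖ ≤ p * ‖A‖ * ‖B‖ := by
  refine (Matrix.norm_le_iff (by positivity)).2 fun i j => ?_
  rw [Matrix.mul_apply]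
  calc ‖∑ r, A i r * B r j‖ ≤ ∑ r : Fin p, ‖A‖ * ‖B‖ := by
        refine (norm_sum_le _ _).trans (Finset.sum_le_sum fun r _ => ?_)
        rw [norm_mul]
        gcongr
        · exact A.norm_entry_le_entrywise_sup_norm
        · exact B.norm_entry_le_entrywise_sup_norm
    _ = _ := by simp [mul_assoc]

theorem HasDerivAt.matrix_mul_s11 {l p q : ℕ} {A : ℝ → Matrix (Fin l) (Fin p) ℂ}
    {B : ℝ → Matrix (Fin p) (Fin q) ℂ} {A' : Matrix (Fin l) (Fin p) ℂ}
    {B' : Matrix (Fin p) (Fin q) ℂ} {t : ℝ} (hA : HasDerivAt A A' t) (hB : HasDerivAt B B' t) :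
    HasDerivAt (fun t => A t * B t) (A' * B t + A t * B') t := by
  refine hasDerivAt_pi.2 fun i => hasDerivAt_pi.2 fun j => ?_
  have h : HasDerivAt (fun t => ∑ r, A t i r * B t r j)
      (∑ r, (A' i r * B t r j + A t i r * B' r j)) t :=
    HasDerivAt.fun_sum fun r _ =>
      (hasDerivAt_pi.1 (hasDerivAt_pi.1 hA i) r).mul (hasDerivAt_pi.1 (hasDerivAt_pi.1 hB r) j)
  rw [Finset.sum_add_distrib] at h
  exact h

theorem HasDerivAt.const_matrix_mul {l p q : ℕ} (A : Matrix (Fin l) (Fin p) ℂ)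
    {B : ℝ → Matrix (Fin p) (Fin q) ℂ} {B' : Matrix (Fin p) (Fin q) ℂ} {t : ℝ}
    (hB : HasDerivAt B B' t) : HasDerivAt (fun t => A * B t) (A * B') t := by
  simpa using (hasDerivAt_const t A).matrix_mul_s11 hB

theorem HasDerivAt.matrix_mul_const {l p q : ℕ} {A : ℝ → Matrix (Fin l) (Fin p) ℂ}
    {A' : Matrix (Fin l) (Fin p) ℂ} {t : ℝ} (hA : HasDerivAt A A' t)
    (B : Matrix (Fin p) (Fin q) ℂ) : HasDerivAt (fun t => A t * B) (A' * B) t := by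
  simpa using hA.matrix_mul_s11 (hasDerivAt_const t B)

theorem HasDerivAt.matrix_conjTranspose_s11 {l p : ℕ} {A : ℝ → Matrix (Fin l) (Fin p) ℂ}
    {A' : Matrix (Fin l) (Fin p) ℂ} {t : ℝ} (hA : HasDerivAt A A' t) :
    HasDerivAt (fun t => (A t)ᴴ) A'ᴴ t :=
  hasDerivAt_pi.2 fun i => hasDerivAt_pi.2 fun j =>
    (hasDerivAt_pi.1 (hasDerivAt_pi.1 hA j) i).star

section CanonicalSystem

variable {m k : ℕ} {J : Matrix (Fin m) (Fin m) ℂ}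

/-- The kernel bound extends from the open triangle to the whole square. -/
theorem norm_kernel_le_abs_sub {a b M : ℝ} (hab : a < b) (hJherm : Jᴴ = J)
    {β : ℝ → Matrix (Fin k) (Fin m) ℂ} (hβ : ContinuousOn β (Icc a b))
    (hker : ∀ t x : ℝ, a ≤ t → t < x → x ≤ b → ‖(x - t)⁻¹ • (β x * J * (β t)ᴴ)‖ ≤ M) :
    ∀ t ∈ Icc a b, ∀ τ ∈ Icc a b, ‖β t * J * (β τ)ᴴ‖ ≤ M * |t - τ| := by
  have h1 : ∀ t ∈ Icc a b, ∀ τ ∈ Icc a b, τ < t → ‖β t * J * (β τ)ᴴ‖ ≤ M * |t - τ| := by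
    intro t ht τ hτ hlt
    have h := hker τ t hτ.1 hlt ht.2
    have hpos : 0 < t - τ := sub_pos.2 hlt
    rw [norm_smul, Real.norm_of_nonneg (inv_nonneg.2 hpos.le), inv_mul_le_iff₀ hpos] at h
    rw [abs_of_pos hpos, mul_comm]
    exact h
  have h2 : ∀ t ∈ Icc a b, ∀ τ ∈ Icc a b, τ ≠ t → ‖β t * J * (β τ)ᴴ‖ ≤ M * |t - τ| := by
    intro t ht τ hτ hne
    rcases lt_or_gt_of_ne hne with h | h
    · exact h1 t ht τ hτ h
    · have h3 := h1 τ hτ t ht h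
      rw [← Matrix.norm_conjTranspose, abs_sub_comm] at h3
      simpa [hJherm, Matrix.mul_assoc] using h3
  intro t ht τ hτ
  have hcl : τ ∈ closure (Ioo a b ∩ {t}ᶜ) := by
    rw [← closure_Ioo hab.ne] at hτ
    exact closure_minimal ((dense_compl_singleton t).open_subset_closure_inter isOpen_Ioo)
      isClosed_closure hτ
  have hsub : Ioo a b ∩ {t}ᶜ ⊆ Icc a b := inter_subset_left.trans Ioo_subset_Icc_self
  refine ContinuousWithinAt.closure_le hcl ?_ (by fun_prop)
    fun τ' hτ' => h2 t ht τ' (hsub hτ') hτ'.2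
  have hcont : Continuous fun X : Matrix (Fin k) (Fin m) ℂ => ‖β t * J * Xᴴ‖ :=
    continuous_norm.comp (by fun_prop)
  exact hcont.continuousAt.comp_continuousWithinAt ((hβ τ hτ).mono hsub)

theorem exists_isSingularVolterra {a b s σ B M : ℝ} (hs : s ∈ Icc a b) (hσ : |σ| = 1)
    (hB : 0 ≤ B) (hM : 0 ≤ M) {β : ℝ → Matrix (Fin k) (Fin m) ℂ}
    (hβ : ContinuousOn β (Icc a b)) (hβB : ∀ t ∈ Icc a b, ‖β t‖ ≤ B)
    (hK : ∀ t ∈ Icc a b, ∀ τ ∈ Icc a b, ‖β t * J * (β τ)ᴴ‖ ≤ M * |t - τ|)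
    {w : ℝ → ℝ → Matrix (Fin m) (Fin m) ℂ} (hwa : ∀ η, 0 < η → w η a = 1)
    (hwd : ∀ η, 0 < η → ∀ x ∈ Icc a b, HasDerivAt (w η)
      ((Complex.I * cauchyKer s (σ * η) x) • (J * ((β x)ᴴ * β x) * w η x)) x) :
    ∃ K, IsSingularVolterra a b s σ B (k * M) β K (fun η t => β t * w η t) := by
  refine ⟨_, IsSingularVolterra.of_bilinear
    (LinearMap.mk₂ ℂ (fun (A : Matrix (Fin k) (Fin k) ℂ) (X : Matrix (Fin k) (Fin m) ℂ) => A * X)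
      Matrix.add_mul Matrix.smul_mul Matrix.mul_add fun c A X => Matrix.mul_smul A c X)
    (κ := fun t τ => Complex.I • (β t * J * (β τ)ᴴ))
    (Nat.cast_nonneg k) (fun A X => Matrix.norm_mul_le_card_mul A X) hs hσ hB hM hβ hβB
    ?_ ?_ ?_ ?_ ?_⟩
  · intro t _
    have hc : Continuous fun X : Matrix (Fin k) (Fin m) ℂ =>
      Complex.I • (β t * J * Xᴴ) := by fun_prop
    exact hc.comp_continuousOn hβ
  · intro τ _
    have hc : Continuous fun X : Matrix (Fin k) (Fin m) ℂ =>
      Complex.I • (X * J * (β τ)ᴴ) := by fun_prop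
    exact hc.comp_continuousOn hβ
  · intro t ht τ hτ
    rw [norm_smul, Complex.norm_I, one_mul]
    exact hK t ht τ hτ
  · intro η hη
    have hc : Continuous fun p : Matrix (Fin k) (Fin m) ℂ × Matrix (Fin m) (Fin m) ℂ =>
      p.1 * p.2 := by fun_prop
    exact hc.comp_continuousOn (hβ.prodMk
      fun x hx => (hwd η hη x hx).continuousAt.continuousWithinAt)
  · intro η hη t ht
    refine ⟨fun τ => β t * w η τ, by simp [hwa η hη], rfl, fun τ hτ => ?_⟩
    refine ((hwd η hη τ hτ).const_matrix_mul (β t)).congr_deriv ?_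
    rw [LinearMap.mk₂_apply, Matrix.mul_smul, Matrix.smul_mul, smul_smul,
      mul_comm (cauchyKer s (σ * η) τ)]
    simp only [Matrix.mul_assoc]

theorem hasDerivAt_conjTranspose_mul_mul (hJherm : Jᴴ = J) (hJinv : J * J = 1)
    {A B : ℝ → Matrix (Fin m) (Fin m) ℂ} {c d : ℂ} {b : Matrix (Fin k) (Fin m) ℂ} {t : ℝ}
    (hA : HasDerivAt A ((Complex.I * c) • (J * (bᴴ * b) * A t)) t)
    (hB : HasDerivAt B ((Complex.I * d) • (J * (bᴴ * b) * B t)) t) :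
    HasDerivAt (fun t => (A t)ᴴ * J * B t)
      ((Complex.I * (d - star c)) • ((b * A t)ᴴ * (b * B t))) t := by
  refine ((hA.matrix_conjTranspose_s11.matrix_mul_const J).matrix_mul_s11 hB).congr_deriv ?_
  have hJJ : ∀ X : Matrix (Fin m) (Fin m) ℂ, J * (J * X) = X := fun X => by
    rw [← Matrix.mul_assoc, hJinv, Matrix.one_mul]
  simp only [Matrix.conjTranspose_smul, Matrix.conjTranspose_mul, hJherm,
    Matrix.conjTranspose_conjTranspose, Matrix.smul_mul, Matrix.mul_smul, Matrix.mul_assoc, hJJ]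
  rw [← add_smul]
  congr 1
  simp
  ring

/-- The `J`-symplectic identity for fundamental solutions at conjugate points. -/
theorem conjTranspose_mul_mul_eq (hJherm : Jᴴ = J) (hJinv : J * J = 1) {a x : ℝ}
    {β : ℝ → Matrix (Fin k) (Fin m) ℂ} {A B : ℝ → Matrix (Fin m) (Fin m) ℂ} {c : ℝ → ℂ}
    (hAa : A a = 1) (hBa : B a = 1)
    (hA : ∀ t ∈ Icc a x, HasDerivAt A
      ((Complex.I * star (c t)) • (J * ((β t)ᴴ * β t) * A t)) t)
    (hB : ∀ t ∈ Icc a x, HasDerivAt B ((Complex.I * c t) • (J * ((β t)ᴴ * β t) * B t)) t) :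
    ∀ t ∈ Icc a x, (A t)ᴴ * J * B t = J := by
  have hd : ∀ t ∈ Icc a x, HasDerivAt (fun t => (A t)ᴴ * J * B t) 0 t := fun t ht =>
    (hasDerivAt_conjTranspose_mul_mul hJherm hJinv (hA t ht) (hB t ht)).congr_deriv (by simp)
  intro t ht
  have := constant_of_has_deriv_right_zero
    (fun t ht => (hd t ht).continuousAt.continuousWithinAt)
    (fun t ht => (hd t (Ico_subset_Icc_self ht)).hasDerivWithinAt) t ht
  simpa [hAa, hBa] using this

theorem one_add_mul_one_add_eq (p r : ℝ) :
    (1 + max (-p) 0 / r) * (1 + max p 0 / r) = 1 + |p| / r := by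
  rcases le_total p 0 with h | h
  · rw [max_eq_left (by linarith), max_eq_right h, abs_of_nonpos h]; simp
  · rw [max_eq_right (by linarith), max_eq_left h, abs_of_nonneg h]; simp

theorem integral_poisson_smul_eq_sub {U : Type*} [NormedAddCommGroup U] [NormedSpace ℝ U]
    [CompleteSpace U] {a x s η : ℝ} (hax : a ≤ x) (hη : η ≠ 0) {Φ g : ℝ → U}
    (hg : ContinuousOn g (Icc a x))
    (hΦ : ∀ t ∈ Icc a x, HasDerivAt Φ ((2 * η / ((t - s) ^ 2 + η ^ 2)) • g t) t) :
    ∫ t in a..x, (2 * η / ((t - s) ^ 2 + η ^ 2)) • g t = Φ x - Φ a := by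
  rw [← uIcc_of_le hax] at hg hΦ
  have hp : Continuous fun t : ℝ => 2 * η / ((t - s) ^ 2 + η ^ 2) :=
    Continuous.div (by fun_prop) (by fun_prop) fun t => by positivity
  exact intervalIntegral.integral_eq_sub_of_hasDerivAt hΦ
    (hp.continuousOn.smul hg).intervalIntegrable

theorem continuousOn_mul_gram {S : Set ℝ} {β : ℝ → Matrix (Fin k) (Fin m) ℂ}
    (hβ : ContinuousOn β S) {A : ℝ → Matrix (Fin m) (Fin m) ℂ} (hA : ContinuousOn A S)
    (C : Matrix (Fin m) (Fin m) ℂ) :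
    ContinuousOn (fun t => C * ((β t * A t)ᴴ * (β t * A t))) S := by
  have h : Continuous fun p : Matrix (Fin k) (Fin m) ℂ × Matrix (Fin m) (Fin m) ℂ =>
    p.1 * p.2 := by fun_prop
  have h' : Continuous fun X : Matrix (Fin k) (Fin m) ℂ => C * (Xᴴ * X) := by fun_prop
  have hβA : ContinuousOn (fun t => β t * A t) S := h.comp_continuousOn (hβ.prodMk hA)
  exact h'.comp_continuousOn hβA

theorem I_mul_cauchyKer_sub_star {s η : ℝ} (hη : η ≠ 0) (t : ℝ) :
    Complex.I * (cauchyKer s η t - star (cauchyKer s η t)) =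
      ((2 * η / ((t - s) ^ 2 + η ^ 2) : ℝ) : ℂ) := by
  have h1 := cauchyKer_den_ne_zero (s := s) hη t
  have h2 := cauchyKer_den_ne_zero (s := s) (neg_ne_zero.2 hη) t
  have h3 : star (cauchyKer s η t) = cauchyKer s (-η) t := by
    simp [cauchyKer, sub_eq_add_neg]
  have h4 : (((t - s) ^ 2 + η ^ 2 : ℝ) : ℂ) =
      ((s : ℂ) + (η : ℂ) * Complex.I - t) * ((s : ℂ) + ((-η : ℝ) : ℂ) * Complex.I - t) := by
    push_cast
    linear_combination (η : ℂ) ^ 2 * Complex.I_sq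
  rw [h3, Complex.ofReal_div, h4]
  unfold cauchyKer
  rw [inv_sub_inv h1 h2, mul_div_assoc']
  congr 1
  push_cast
  linear_combination (-2 * (η : ℂ)) * Complex.I_sq

/-- The difference of the fundamental solutions at conjugate points as a Poisson integral. -/
theorem sub_eq_integral_poisson (hJherm : Jᴴ = J) (hJinv : J * J = 1) {a x s η : ℝ} (hax : a ≤ x)
    (hη : 0 < η) {β : ℝ → Matrix (Fin k) (Fin m) ℂ} (hβ : ContinuousOn β (Icc a x))
    {A : ℝ → Matrix (Fin m) (Fin m) ℂ} {B : Matrix (Fin m) (Fin m) ℂ} (hAa : A a = 1)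
    (hA : ∀ t ∈ Icc a x, HasDerivAt A
      ((Complex.I * cauchyKer s η t) • (J * ((β t)ᴴ * β t) * A t)) t)
    (hAB : B * J * (A x)ᴴ * J = 1) :
    A x - B = ∫ t in a..x, (2 * η / ((t - s) ^ 2 + η ^ 2)) •
      (B * J * ((β t * A t)ᴴ * (β t * A t))) := by
  have hd : ∀ t ∈ Icc a x, HasDerivAt (fun t => B * J * ((A t)ᴴ * J * A t))
      ((2 * η / ((t - s) ^ 2 + η ^ 2)) • (B * J * ((β t * A t)ᴴ * (β t * A t)))) t := by
    intro t ht
    refine ((hasDerivAt_conjTranspose_mul_mul hJherm hJinv (hA t ht)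
      (hA t ht)).const_matrix_mul (B * J)).congr_deriv ?_
    rw [I_mul_cauchyKer_sub_star hη.ne', Matrix.mul_smul, Complex.coe_smul]
  have hAc : ContinuousOn A (Icc a x) := fun t ht => (hA t ht).continuousAt.continuousWithinAt
  rw [integral_poisson_smul_eq_sub hax hη.ne' (continuousOn_mul_gram hβ hAc (B * J)) hd, hAa]
  congr 1
  · rw [← Matrix.mul_assoc, ← Matrix.mul_assoc, hAB, Matrix.one_mul]
  · simp [Matrix.mul_assoc, hJinv]

theorem exists_tendsto_jump (hJherm : Jᴴ = J) (hJinv : J * J = 1) {a x s Λ B M : ℝ}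
    (hs : s ∈ Icc a x) (hΛ : x - a ≤ Λ) (hB : 0 ≤ B) (hM : 0 ≤ M)
    {β : ℝ → Matrix (Fin k) (Fin m) ℂ} (hβ : ContinuousOn β (Icc a x))
    (hβB : ∀ t ∈ Icc a x, ‖β t‖ ≤ B)
    (hK : ∀ t ∈ Icc a x, ∀ τ ∈ Icc a x, ‖β t * J * (β τ)ᴴ‖ ≤ M * |t - τ|)
    {A A' : ℝ → ℝ → Matrix (Fin m) (Fin m) ℂ} (hAa : ∀ η, 0 < η → A η a = 1)
    (hAa' : ∀ η, 0 < η → A' η a = 1)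
    (hA : ∀ η, 0 < η → ∀ t ∈ Icc a x, HasDerivAt (A η)
      ((Complex.I * cauchyKer s η t) • (J * ((β t)ᴴ * β t) * A η t)) t)
    (hA' : ∀ η, 0 < η → ∀ t ∈ Icc a x, HasDerivAt (A' η)
      ((Complex.I * cauchyKer s (-η) t) • (J * ((β t)ᴴ * β t) * A' η t)) t) :
    ∃ V, Tendsto (fun η => A η x - A' η x) (𝓝[>] 0) (𝓝 V) ∧
      ‖V‖ ≤ ∫ y : ℝ, (m * ‖J‖ * k * IsSingularVolterra.growthConst B (k * M) Λ ^ 2) *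
        (4 * (1 + √Λ) * (1 + ‖y‖) ^ (-(3 / 2) : ℝ)) := by
  have hax : a ≤ x := hs.1.trans hs.2
  have hxx : x ∈ Icc a x := right_mem_Icc.2 hax
  have hstar : ∀ h t, star (cauchyKer s h t) = cauchyKer s (-h) t := by
    intro h t; simp [cauchyKer, sub_eq_add_neg]
  have hJ1 : ∀ η, 0 < η → (A η x)ᴴ * J * A' η x = J := fun η hη =>
    conjTranspose_mul_mul_eq hJherm hJinv (c := cauchyKer s (-η)) (hAa η hη) (hAa' η hη)
      (fun t ht => by rw [hstar, neg_neg]; exact hA η hη t ht) (hA' η hη) x hxx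
  have hinv : ∀ η, 0 < η → A' η x * J * (A η x)ᴴ * J = 1 := by
    intro η hη
    have h : (J * (A η x)ᴴ * J) * A' η x = 1 := by
      rw [Matrix.mul_assoc J, Matrix.mul_assoc J, hJ1 η hη, hJinv]
    simpa [Matrix.mul_assoc] using mul_eq_one_comm.1 h
  have hJ2 : ∀ η, 0 < η → A η x * J * (A' η x)ᴴ * J = 1 := by
    intro η hη
    have h1 := congrArg Matrix.conjTranspose (hinv η hη)
    simp only [Matrix.conjTranspose_mul, hJherm, Matrix.conjTranspose_conjTranspose,
      Matrix.conjTranspose_one] at h1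
    have h2 : J * (A η x * (J * (A' η x)ᴴ)) = 1 := h1
    simpa [Matrix.mul_assoc] using mul_eq_one_comm.1 h2
  obtain ⟨K, H⟩ := exists_isSingularVolterra (σ := 1) hs (by simp) hB hM hβ hβB hK hAa
    (by simpa using hA)
  set w : ℝ → ℝ → Matrix (Fin m) (Fin m) ℂ :=
    fun η y => A η (-y) * (J * (A' η x)ᴴ * J) with hw
  have hneg : ∀ y ∈ Icc (-x) (-a), -y ∈ Icc a x := fun y hy =>
    ⟨by linarith [hy.2], by linarith [hy.1]⟩
  have hwd : ∀ η, 0 < η → ∀ y ∈ Icc (-x) (-a), HasDerivAt (w η)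
      ((Complex.I * cauchyKer (-s) ((-1) * η) y) •
        (J * ((β (-y))ᴴ * β (-y)) * w η y)) y := by
    intro η hη y hy
    have h1 := (hA η hη (-y) (hneg y hy)).scomp y (hasDerivAt_neg y)
    refine (h1.matrix_mul_const (J * (A' η x)ᴴ * J)).congr_deriv ?_
    have hk : cauchyKer (-s) ((-1) * η) y = - cauchyKer s η (-y) := by
      unfold cauchyKer
      rw [← inv_neg]
      congr 1
      push_cast; ring
    rw [hk, neg_smul, one_smul, mul_neg, neg_smul, Matrix.neg_mul, Matrix.smul_mul]
    simp only [hw, Matrix.mul_assoc]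
  obtain ⟨K', H'⟩ := exists_isSingularVolterra (σ := -1) (s := -s) (a := -x) (b := -a) (J := J)
    (β := fun y => β (-y)) ⟨neg_le_neg hs.2, neg_le_neg hs.1⟩ (by simp) hB hM
    (hβ.comp (by fun_prop) hneg) (fun y hy => hβB _ (hneg y hy))
    (fun t ht τ hτ => by
      have := hK _ (hneg t ht) _ (hneg τ hτ)
      rwa [← neg_sub', abs_neg] at this)
    (w := w) (fun η hη => by
      simpa [hw, Matrix.mul_assoc] using hJ2 η hη) hwd
  set g := IsSingularVolterra.growthConst B (k * M) Λ with hg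
  set G : ℝ → ℝ → Matrix (Fin m) (Fin m) ℂ := fun η t =>
    J * ((β t * w η (-t))ᴴ * (β t * A η t)) with hG
  have hGeq : ∀ η t, G η t = A' η x * J * ((β t * A η t)ᴴ * (β t * A η t)) := by
    intro η t
    have hJJ : ∀ X : Matrix (Fin m) (Fin m) ℂ, J * (J * X) = X := fun X => by
      rw [← Matrix.mul_assoc, hJinv, Matrix.one_mul]
    simp only [hG, hw, neg_neg, Matrix.conjTranspose_mul, hJherm,
      Matrix.conjTranspose_conjTranspose, Matrix.mul_assoc, hJJ]
  have hAc : ∀ η, 0 < η → ContinuousOn (A η) (Icc a x) := fun η hη t ht =>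
    (hA η hη t ht).continuousAt.continuousWithinAt
  have hGc : ∀ η, 0 < η → ContinuousOn (G η) (Icc a x) := by
    intro η hη
    rw [show G η = _ from funext (hGeq η)]
    exact continuousOn_mul_gram hβ (hAc η hη) _
  have hg0 : 0 ≤ g := (H.baseConst_nonneg hΛ).trans (H.baseConst_le_growthConst hΛ)
  have hGb : ∀ η, 0 < η → η ≤ 1 → ∀ t ∈ Icc a x,
      ‖G η t‖ ≤ (m * ‖J‖ * k * g ^ 2) * (1 + |t - s| / √η) := by
    intro η hη hη1 t ht
    have h1 := H.norm_sol_le_growthConst hΛ hη hη1 ht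
    have h2 := H'.norm_sol_le_growthConst (Λ := Λ) (by linarith) hη hη1 (t := -t)
      ⟨neg_le_neg ht.2, neg_le_neg ht.1⟩
    simp only [neg_neg] at h2
    rw [show -t - -s = -(t - s) by ring] at h2
    have h3 : ‖(β t * w η (-t))ᴴ * (β t * A η t)‖ ≤
        k * ‖β t * w η (-t)‖ * ‖β t * A η t‖ := by
      have := Matrix.norm_mul_le_card_mul (β t * w η (-t))ᴴ (β t * A η t)
      rwa [Matrix.norm_conjTranspose] at this
    calc ‖G η t‖ ≤ m * ‖J‖ * ‖(β t * w η (-t))ᴴ * (β t * A η t)‖ :=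
          Matrix.norm_mul_le_card_mul _ _
      _ ≤ m * ‖J‖ * (k * (g * (1 + max (-(t - s)) 0 / √η)) * (g * (1 + max (t - s) 0 / √η))) := by
          refine mul_le_mul_of_nonneg_left (h3.trans ?_) (by positivity)
          gcongr
      _ = (m * ‖J‖ * k * g ^ 2) *
          ((1 + max (-(t - s)) 0 / √η) * (1 + max (t - s) 0 / √η)) := by ring
      _ = _ := by rw [one_add_mul_one_add_eq]
  obtain ⟨u₀, hu₀⟩ := H.exists_tendsto_sol
  obtain ⟨v₀, hv₀⟩ := H'.exists_tendsto_sol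
  have hlim : ∀ y : ℝ, (∀ᶠ η in 𝓝[>] (0 : ℝ), s + η * y ∈ Icc a x) →
      Tendsto (fun η => G η (s + η * y)) (𝓝[>] 0) (𝓝 (J * (v₀ᴴ * u₀))) := by
    intro y hy
    have h1 := hu₀ y hy
    have h2 := hv₀ (-y) (by
      filter_upwards [hy] with η hyη
      constructor <;> nlinarith [hyη.1, hyη.2])
    have h3 : Continuous fun p : Matrix (Fin k) (Fin m) ℂ × Matrix (Fin k) (Fin m) ℂ =>
      J * (p.1ᴴ * p.2) := by fun_prop
    have h4 := (h3.tendsto (v₀, u₀)).comp (h2.prodMk_nhds h1)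
    refine h4.congr fun η => ?_
    have e : -s + η * -y = -(s + η * y) := by ring
    simp only [Function.comp, hG, e, neg_neg]
  obtain ⟨V, hV, hVb⟩ := exists_tendsto_integral_poisson hs hΛ (by positivity) hGc hGb hlim
  refine ⟨V, hV.congr' ?_, hVb⟩
  filter_upwards [self_mem_nhdsWithin] with η hη
  rw [sub_eq_integral_poisson hJherm hJinv hax hη hβ (hAa η hη) (hA η hη) (hinv η hη)]
  simp only [hGeq]

end CanonicalSystem

end

/-- Lemma 3.1: under the kernel bound (2.6), the jump
`V(x,s) = lim_{η→0+}(W(x,s+iη) − W(x,s−iη))` of the fundamental solution across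
the real axis exists on the triangle `a ≤ s ≤ x ≤ b` and is uniformly bounded. -/
theorem stmt_11 {m k : ℕ} (a b : ℝ) (hab : a ≤ b)
    (J : Matrix (Fin m) (Fin m) ℂ) (hJherm : Jᴴ = J) (hJinv : J * J = 1)
    (β : ℝ → Matrix (Fin k) (Fin m) ℂ) (hβcont : ContinuousOn β (Set.Icc a b))
    (M : ℝ) (hM : 0 < M)
    (hker : ∀ t x : ℝ, a ≤ t → t < x → x ≤ b →
      ‖(x - t)⁻¹ • (β x * J * (β t)ᴴ)‖ ≤ M)
    (W : ℝ → ℂ → Matrix (Fin m) (Fin m) ℂ)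
    (hW : ∀ z : ℂ, z.im ≠ 0 → W a z = 1 ∧
      ∀ x ∈ Set.Icc a b, HasDerivAt (fun t : ℝ => W t z)
        ((Complex.I * (z - (x : ℂ))⁻¹) • (J * ((β x)ᴴ * β x) * W x z)) x) :
    ∃ M₁ : ℝ, 0 < M₁ ∧ ∀ x s : ℝ, a ≤ s → s ≤ x → x ≤ b →
      ∃ V : Matrix (Fin m) (Fin m) ℂ,
        Filter.Tendsto
          (fun η : ℝ => W x ((s : ℂ) + (η : ℂ) * Complex.I) -
            W x ((s : ℂ) - (η : ℂ) * Complex.I))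
          (nhdsWithin 0 (Set.Ioi 0)) (nhds V) ∧ ‖V‖ ≤ M₁ := by
  have him : ∀ s η : ℝ, 0 < η → ((s : ℂ) + (η : ℂ) * Complex.I).im ≠ 0 := fun s η hη => by
    simpa using hη.ne'
  have him' : ∀ s η : ℝ, 0 < η → ((s : ℂ) - (η : ℂ) * Complex.I).im ≠ 0 := fun s η hη => by
    simpa using hη.ne'
  rcases hab.eq_or_lt with rfl | hlt
  · refine ⟨1, one_pos, fun x s h1 h2 h3 => ⟨0, ?_, by simp⟩⟩
    obtain rfl : x = a := le_antisymm h3 (h1.trans h2)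
    refine tendsto_const_nhds.congr' ?_
    filter_upwards [self_mem_nhdsWithin] with η hη
    rw [(hW _ (him s η hη)).1, (hW _ (him' s η hη)).1, sub_self]
  obtain ⟨B, hB⟩ := isCompact_Icc.exists_bound_of_continuousOn hβcont
  have hB0 : 0 ≤ B := (norm_nonneg _).trans (hB a (Set.left_mem_Icc.2 hab))
  have hK := norm_kernel_le_abs_sub hlt hJherm hβcont hker
  refine ⟨(∫ y : ℝ, (m * ‖J‖ * k * IsSingularVolterra.growthConst B (k * M) (b - a) ^ 2) *
    (4 * (1 + √(b - a)) * (1 + ‖y‖) ^ (-(3 / 2) : ℝ))) + 1, ?_, fun x s has hsx hxb => ?_⟩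
  · have : 0 ≤ ∫ y : ℝ, (m * ‖J‖ * k * IsSingularVolterra.growthConst B (k * M) (b - a) ^ 2) *
        (4 * (1 + √(b - a)) * (1 + ‖y‖) ^ (-(3 / 2) : ℝ)) :=
      MeasureTheory.integral_nonneg fun y => by positivity
    linarith
  have hsub : Set.Icc a x ⊆ Set.Icc a b := Set.Icc_subset_Icc le_rfl hxb
  obtain ⟨V, hV, hVb⟩ := exists_tendsto_jump hJherm hJinv (a := a) (x := x) (s := s)
    (Λ := b - a) ⟨has, hsx⟩ (by linarith) hB0 hM.le (hβcont.mono hsub)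
    (fun t ht => hB t (hsub ht)) (fun t ht τ hτ => hK t (hsub ht) τ (hsub hτ))
    (A := fun η t => W t ((s : ℂ) + (η : ℂ) * Complex.I))
    (A' := fun η t => W t ((s : ℂ) - (η : ℂ) * Complex.I))
    (fun η hη => (hW _ (him s η hη)).1) (fun η hη => (hW _ (him' s η hη)).1)
    (fun η hη t ht => (hW _ (him s η hη)).2 t (hsub ht))
    (fun η hη t ht => by
      have h := (hW _ (him' s η hη)).2 t (hsub ht)
      have e : cauchyKer s (-η) t = ((s : ℂ) - (η : ℂ) * Complex.I - (t : ℂ))⁻¹ := by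
        simp [cauchyKer, sub_eq_add_neg]
      rw [e]
      exact h)
  exact ⟨V, hV, hVb.trans (by linarith)⟩
end

section
/- Let J ∈ ℂ^{m×m} with J = J* = J^{−1}, let β : [a,b] → ℂ^{k×m} be continuous, H(x) = β(x)*β(x), and let 𝔄 be the bounded operator on L²_k(a,b) given by (𝔄 f)(x) = x f(x) + i ∫_a^x β(x) J β(t)* f(t) dt. Fix z ∈ ℂ with z ∉ [a,b], and let W(x,z) be the fundamental solution of w_x = i(z−x)^{−1} J H(x) w with W(a,z) = I_m. Then for every c ∈ ℂ^m, the L²_k(a,b)-function f_c(x) := (z−x)^{−1} β(x) W(x,z) c satisfies ((𝔄 − z I) f_c)(x) = −β(x) c for all x ∈ [a,b]; equivalently, (𝔄 − z I)^{−1} applied to the function x ↦ β(x) c equals x ↦ (x−z)^{−1} β(x) W(x,z) c. -/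
open Matrix

attribute [local instance] Matrix.normedAddCommGroup Matrix.normedSpace

/-- the resolvent identity (c.4): for the triangular Livšic model
operator `(𝔄 f)(x) = x f(x) + i ∫_a^x β(x) J β(t)* f(t) dt`, the function
`f_c(x) = (z−x)⁻¹ β(x) W(x,z) c` satisfies `((𝔄 − z I) f_c)(x) = −β(x) c`. -/
theorem stmt_15 {m k : ℕ} (a b : ℝ) (hab : a ≤ b)
    (J : Matrix (Fin m) (Fin m) ℂ) (hJherm : Jᴴ = J) (hJinv : J * J = 1)
    (β : ℝ → Matrix (Fin k) (Fin m) ℂ) (hβcont : ContinuousOn β (Set.Icc a b))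
    (z : ℂ) (hz : ∀ x ∈ Set.Icc a b, z ≠ (x : ℂ))
    (W : ℝ → Matrix (Fin m) (Fin m) ℂ) (hWa : W a = 1)
    (hW : ∀ x ∈ Set.Icc a b, HasDerivAt W
      ((Complex.I * (z - (x : ℂ))⁻¹) • (J * ((β x)ᴴ * β x) * W x)) x)
    (c : Fin m → ℂ) :
    ∀ x ∈ Set.Icc a b,
      (x : ℂ) • ((z - (x : ℂ))⁻¹ • (β x * W x).mulVec c) +
        Complex.I • (∫ t in a..x,
          (β x * J * (β t)ᴴ).mulVec ((z - (t : ℂ))⁻¹ • (β t * W t).mulVec c)) -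
        z • ((z - (x : ℂ))⁻¹ • (β x * W x).mulVec c) =
      -((β x).mulVec c) := by
  intro x hx
  have hsub : Set.uIcc a x ⊆ Set.Icc a b := by
    rw [Set.uIcc_of_le hx.1]
    exact Set.Icc_subset_Icc_right hx.2
  let L : Matrix (Fin m) (Fin m) ℂ →ₗ[ℂ] (Fin k → ℂ) :=
    { toFun := fun M => (β x * M).mulVec c
      map_add' := fun M N => by rw [Matrix.mul_add, Matrix.add_mulVec]
      map_smul' := fun r M => by
        rw [Matrix.mul_smul, Matrix.smul_mulVec, RingHom.id_apply] }
  have hderiv : ∀ t ∈ Set.uIcc a x, HasDerivAt (fun t => (β x * W t).mulVec c)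
      (Complex.I • (β x * J * (β t)ᴴ).mulVec ((z - (t : ℂ))⁻¹ • (β t * W t).mulVec c)) t := by
    intro t ht
    have h := ((L.toContinuousLinearMap.restrictScalars ℝ).hasFDerivAt
      (x := W t)).comp_hasDerivAt t (hW t (hsub ht))
    refine h.congr_deriv ?_
    change (β x * ((Complex.I * (z - (t : ℂ))⁻¹) • (J * ((β t)ᴴ * β t) * W t))).mulVec c = _
    rw [Matrix.mulVec_smul, Matrix.mulVec_mulVec, Matrix.mul_smul, Matrix.smul_mulVec, smul_smul]
    simp only [Matrix.mul_assoc]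
  have hWcont : ContinuousOn W (Set.uIcc a x) := fun t ht =>
    (hW t (hsub ht)).continuousAt.continuousWithinAt
  have hβ : ContinuousOn β (Set.uIcc a x) := hβcont.mono hsub
  have hinv : ContinuousOn (fun t : ℝ => (z - (t : ℂ))⁻¹) (Set.uIcc a x) :=
    ContinuousOn.inv₀ (by fun_prop) fun t ht => sub_ne_zero.mpr (hz t (hsub ht))
  have hcont : ContinuousOn (fun t : ℝ => Complex.I •
      (β x * J * (β t)ᴴ).mulVec ((z - (t : ℂ))⁻¹ • (β t * W t).mulVec c)) (Set.uIcc a x) := by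
    rw [continuousOn_iff_continuous_domRestrict] at *
    exact (Continuous.matrix_mulVec (continuous_const.matrix_mul hβ.matrix_conjTranspose)
      (hinv.smul ((hβ.matrix_mul hWcont).matrix_mulVec continuous_const))).const_smul Complex.I
  have hint := intervalIntegral.integral_eq_sub_of_hasDerivAt hderiv hcont.intervalIntegrable
  rw [intervalIntegral.integral_smul] at hint
  have hne : z - (x : ℂ) ≠ 0 := sub_ne_zero.mpr (hz x hx)
  rw [hint, hWa, Matrix.mul_one]
  ext i
  simp only [Pi.add_apply, Pi.sub_apply, Pi.smul_apply, Pi.neg_apply, smul_eq_mul]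
  field_simp
  ring
end

section
/- Let J ∈ ℂ^{m×m} with J = J* = J^{−1}, let β : [a,b] → ℂ^{k×m} be continuous, H(x) = β(x)*β(x), and let 𝔄 be the bounded operator on L²_k(a,b) given by (𝔄 f)(x) = x f(x) + i ∫_a^x β(x) J β(t)* f(t) dt. Define 𝒦 : ℂ^m → L²_k(a,b) by (𝒦 g)(x) = β(x) g, so that 𝒦* f = ∫_a^b β(t)* f(t) dt. Then for every z ∈ ℂ with z ∉ [a,b], the Livšic–Brodskii characteristic matrix function 𝒲(z) = I_m − i J 𝒦* (𝔄 − z I)^{−1} 𝒦 equals W(b,z), where W(x,z) is the fundamental solution of w_x = i(z−x)^{−1} J H(x) w with W(a,z) = I_m. Equivalently, I_m − i J ∫_a^b (t−z)^{−1} β(t)* β(t) W(t,z) dt = W(b,z). -/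
open Matrix MeasureTheory

attribute [local instance] Matrix.normedAddCommGroup Matrix.normedSpace

/-- A linear map between finite-dimensional spaces commutes with interval integrals of functions
continuous on the interval of integration. -/
theorem LinearMap.map_intervalIntegral_of_continuousOn {E F : Type*} [NormedAddCommGroup E]
    [NormedSpace ℂ E] [FiniteDimensional ℂ E] [NormedAddCommGroup F] [NormedSpace ℂ F]
    [FiniteDimensional ℂ F] (L : E →ₗ[ℂ] F) {a x : ℝ} (hax : a ≤ x) {G : ℝ → E}
    (hG : ContinuousOn G (Set.Icc a x)) :
    ∫ t in a..x, L (G t) = L (∫ t in a..x, G t) := by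
  have : CompleteSpace E := FiniteDimensional.complete ℂ E
  have : CompleteSpace F := FiniteDimensional.complete ℂ F
  exact L.toContinuousLinearMap.intervalIntegral_comp_comm (hG.intervalIntegrable_of_Icc hax)

/-- The fundamental theorem of calculus for a derivative factoring through a linear map. -/
theorem LinearMap.map_intervalIntegral_eq_sub_of_hasDerivAt {E F : Type*} [NormedAddCommGroup E]
    [NormedSpace ℂ E] [FiniteDimensional ℂ E] [NormedAddCommGroup F] [NormedSpace ℂ F]
    [FiniteDimensional ℂ F] (L : E →ₗ[ℂ] F) {a x : ℝ} (hax : a ≤ x) {G : ℝ → E} {w : ℝ → F}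
    (hG : ContinuousOn G (Set.Icc a x)) (hw : ∀ t ∈ Set.Icc a x, HasDerivAt w (L (G t)) t) :
    L (∫ t in a..x, G t) = w x - w a := by
  have : CompleteSpace F := FiniteDimensional.complete ℂ F
  rw [← L.map_intervalIntegral_of_continuousOn hax hG]
  refine intervalIntegral.integral_eq_sub_of_hasDerivAt (by rwa [Set.uIcc_of_le hax]) ?_
  exact (L.toContinuousLinearMap.continuous.comp_continuousOn hG).intervalIntegrable_of_Icc hax

/-- The integrated form of `w' = i (z - x)⁻¹ J H w`, `w(a) = 1`. -/
theorem one_sub_integral_eq_of_hasDerivAt {m : ℕ} {a b : ℝ} {z : ℂ}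
    (J : Matrix (Fin m) (Fin m) ℂ)
    {H w : ℝ → Matrix (Fin m) (Fin m) ℂ} (hwa : w a = 1)
    (hw : ∀ x ∈ Set.Icc a b, HasDerivAt w ((Complex.I * (z - (x : ℂ))⁻¹) • (J * H x * w x)) x)
    (hG : ContinuousOn (fun t : ℝ => ((t : ℂ) - z)⁻¹ • (H t * w t)) (Set.Icc a b))
    {x : ℝ} (hx : x ∈ Set.Icc a b) :
    1 - Complex.I • (J * ∫ t in a..x, ((t : ℂ) - z)⁻¹ • (H t * w t)) = w x := by
  have hsub : Set.Icc a x ⊆ Set.Icc a b := Set.Icc_subset_Icc_right hx.2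
  let L : Matrix (Fin m) (Fin m) ℂ →ₗ[ℂ] Matrix (Fin m) (Fin m) ℂ :=
    -Complex.I • LinearMap.mulLeft ℂ J
  have hL : ∀ M, L M = -Complex.I • (J * M) := fun M => rfl
  have hderiv : ∀ t ∈ Set.Icc a x,
      HasDerivAt w (L (((t : ℂ) - z)⁻¹ • (H t * w t))) t := by
    intro t ht
    convert hw t (hsub ht) using 1
    rw [hL, Matrix.mul_smul, smul_smul, Matrix.mul_assoc, ← neg_sub z, inv_neg]
    congr 1
    ring
  have key := L.map_intervalIntegral_eq_sub_of_hasDerivAt hx.1 (hG.mono hsub) hderiv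
  rw [hL, hwa, neg_smul] at key
  rw [sub_eq_add_neg, key]
  abel

/-- Products of matrix-valued functions continuous on a set are continuous on that set. -/
theorem ContinuousOn.matrix_mul {X l m n : Type*} [TopologicalSpace X] [Fintype m]
    {A : X → Matrix l m ℂ} {B : X → Matrix m n ℂ} {s : Set X}
    (hA : ContinuousOn A s) (hB : ContinuousOn B s) : ContinuousOn (fun x => A x * B x) s :=
  (continuous_fst.matrix_mul continuous_snd).comp_continuousOn (hA.prodMk hB)

/-- the Livšic–Brodskii characteristic matrix function
`𝒲(z) = I_m − i J 𝒦* (𝔄 − z I)⁻¹ 𝒦` of the triangular model operator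
`(𝔄 f)(x) = x f(x) + i ∫_a^x β(x) J β(t)* f(t) dt` on `L²_k(a,b)`
equals `W(b,z)`; equivalently,
`I_m − i J ∫_a^b (t−z)⁻¹ β(t)* β(t) W(t,z) dt = W(b,z)`. -/
theorem stmt_16 {m k : ℕ} (a b : ℝ) (hab : a ≤ b)
    (J : Matrix (Fin m) (Fin m) ℂ) (hJherm : Jᴴ = J) (hJinv : J * J = 1)
    (β : ℝ → Matrix (Fin k) (Fin m) ℂ) (hβcont : ContinuousOn β (Set.Icc a b))
    (𝔄 : Lp (EuclideanSpace ℂ (Fin k)) 2 (volume.restrict (Set.Ioo a b)) →L[ℂ]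
      Lp (EuclideanSpace ℂ (Fin k)) 2 (volume.restrict (Set.Ioo a b)))
    (h𝔄 : ∀ f : Lp (EuclideanSpace ℂ (Fin k)) 2 (volume.restrict (Set.Ioo a b)),
      ∀ᵐ x ∂(volume.restrict (Set.Ioo a b)),
        (𝔄 f) x = (x : ℂ) • f x + Complex.I •
          ∫ t in a..x, (WithLp.equiv 2 (Fin k → ℂ)).symm
            ((β x * J * (β t)ᴴ).mulVec (WithLp.equiv 2 (Fin k → ℂ) (f t))))
    (𝒦 : EuclideanSpace ℂ (Fin m) →L[ℂ]
      Lp (EuclideanSpace ℂ (Fin k)) 2 (volume.restrict (Set.Ioo a b)))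
    (h𝒦 : ∀ g : EuclideanSpace ℂ (Fin m),
      ∀ᵐ x ∂(volume.restrict (Set.Ioo a b)),
        (𝒦 g) x = (WithLp.equiv 2 (Fin k → ℂ)).symm
          ((β x).mulVec (WithLp.equiv 2 (Fin m → ℂ) g)))
    (R : ℂ → (Lp (EuclideanSpace ℂ (Fin k)) 2 (volume.restrict (Set.Ioo a b)) →L[ℂ]
      Lp (EuclideanSpace ℂ (Fin k)) 2 (volume.restrict (Set.Ioo a b))))
    (hR : ∀ z : ℂ, (∀ x ∈ Set.Icc a b, z ≠ (x : ℂ)) →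
      (𝔄 - z • ContinuousLinearMap.id ℂ _).comp (R z) = ContinuousLinearMap.id ℂ _ ∧
      (R z).comp (𝔄 - z • ContinuousLinearMap.id ℂ _) = ContinuousLinearMap.id ℂ _)
    (W : ℝ → ℂ → Matrix (Fin m) (Fin m) ℂ)
    (hW : ∀ z : ℂ, (∀ x ∈ Set.Icc a b, z ≠ (x : ℂ)) → W a z = 1 ∧
      ∀ x ∈ Set.Icc a b, HasDerivAt (fun t : ℝ => W t z)
        ((Complex.I * (z - (x : ℂ))⁻¹) • (J * ((β x)ᴴ * β x) * W x z)) x) :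
    ∀ z : ℂ, (∀ x ∈ Set.Icc a b, z ≠ (x : ℂ)) →
      ((1 : Matrix (Fin m) (Fin m) ℂ) - Complex.I •
          (J * Matrix.of fun p q : Fin m =>
            (∫ x in a..b, ((β x)ᴴ).mulVec (WithLp.equiv 2 (Fin k → ℂ)
              ((R z (𝒦 (EuclideanSpace.single q 1))) x))) p) = W b z)
      ∧ (1 : Matrix (Fin m) (Fin m) ℂ) - Complex.I •
          (J * ∫ t in a..b, ((t : ℂ) - z)⁻¹ • ((β t)ᴴ * β t * W t z)) = W b z := by
  intro z hz
  obtain ⟨hWa, hWd⟩ := hW z hz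
  have hWc : ContinuousOn (fun t => W t z) (Set.Icc a b) :=
    fun x hx => (hWd x hx).continuousAt.continuousWithinAt
  have hinv : ContinuousOn (fun t : ℝ => ((t : ℂ) - z)⁻¹) (Set.Icc a b) :=
    ContinuousOn.inv₀ (by fun_prop) fun x hx => sub_ne_zero.mpr (hz x hx).symm
  have hβW : ContinuousOn (fun t : ℝ => ((t : ℂ) - z)⁻¹ • (β t * W t z)) (Set.Icc a b) :=
    hinv.smul (ContinuousOn.matrix_mul hβcont hWc)
  have hG : ContinuousOn (fun t : ℝ => ((t : ℂ) - z)⁻¹ • ((β t)ᴴ * β t * W t z))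
      (Set.Icc a b) :=
    hinv.smul (ContinuousOn.matrix_mul (ContinuousOn.matrix_mul
      (continuous_id.matrix_conjTranspose.comp_continuousOn hβcont) hβcont) hWc)
  have hrep := fun x hx => one_sub_integral_eq_of_hasDerivAt J
    (H := fun t => (β t)ᴴ * β t) (w := fun t => W t z) hWa hWd hG (x := x) hx
  refine ⟨?_, hrep b ⟨hab, le_rfl⟩⟩
  rw [← hrep b ⟨hab, le_rfl⟩]
  congr 3
  ext p q
  let v : Fin m → ℂ := Pi.single q 1
  let ev : Matrix (Fin k) (Fin m) ℂ →ₗ[ℂ] EuclideanSpace ℂ (Fin k) :=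
    (WithLp.linearEquiv 2 ℂ (Fin k → ℂ)).symm.toLinearMap ∘ₗ (Matrix.mulVecBilin ℂ ℂ).flip v
  have hev : ∀ M, ev M = WithLp.toLp 2 (M *ᵥ v) := fun M => rfl
  let F : ℝ → EuclideanSpace ℂ (Fin k) := fun t => ev (((t : ℂ) - z)⁻¹ • (β t * W t z))
  have hFc : ContinuousOn F (Set.Icc a b) :=
    ev.toContinuousLinearMap.continuous.comp_continuousOn hβW
  have hF : MemLp F 2 (volume.restrict (Set.Ioo a b)) := by
    obtain ⟨C, hC⟩ := isCompact_Icc.exists_bound_of_continuousOn hFc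
    exact MemLp.of_bound
      ((hFc.mono Set.Ioo_subset_Icc_self).aestronglyMeasurable measurableSet_Ioo) C
      ((ae_restrict_mem measurableSet_Ioo).mono fun t ht => hC t (Set.Ioo_subset_Icc_self ht))
  have hFae := hF.coeFn_toLp
  have hβF : ∀ t, (β t)ᴴ *ᵥ (F t).ofLp = (((t : ℂ) - z)⁻¹ • ((β t)ᴴ * β t * W t z)) *ᵥ v := by
    intro t
    simp only [F, hev, Matrix.mulVec_mulVec, Matrix.mul_smul, Matrix.mul_assoc]
  have hsolve : (𝔄 - z • ContinuousLinearMap.id ℂ _ : _ →L[ℂ] _) hF.toLp =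
      𝒦 (EuclideanSpace.single q 1) := by
    apply Lp.ext
    have hsub := Lp.coeFn_sub (𝔄 hF.toLp) (z • hF.toLp)
    have hsmul := Lp.coeFn_smul z hF.toLp
    simp only [_root_.sub_apply, _root_.smul_apply, ContinuousLinearMap.id_apply]
    filter_upwards [hsub, hsmul, h𝔄 hF.toLp, h𝒦 (EuclideanSpace.single q 1), hFae,
      ae_restrict_mem measurableSet_Ioo] with x h1 h2 h3 h4 h5 hx
    have hxI := Set.Ioo_subset_Icc_self hx
    rw [h1, Pi.sub_apply, h2, Pi.smul_apply, h3, h4, h5]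
    have hint : (∫ t in a..x, (WithLp.equiv 2 (Fin k → ℂ)).symm
        ((β x * J * (β t)ᴴ).mulVec (WithLp.equiv 2 (Fin k → ℂ) (hF.toLp F t)))) =
        ev (β x * J * ∫ t in a..x, ((t : ℂ) - z)⁻¹ • ((β t)ᴴ * β t * W t z)) := by
      let L : Matrix (Fin m) (Fin m) ℂ →ₗ[ℂ] EuclideanSpace ℂ (Fin k) :=
        ev ∘ₗ mulLeftLinearMap (Fin m) ℂ (β x * J)
      refine Eq.trans ?_ (L.map_intervalIntegral_of_continuousOn hxI.1
        (hG.mono (Set.Icc_subset_Icc_right hxI.2)))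
      apply intervalIntegral.integral_congr_ae
      filter_upwards [(ae_restrict_iff' measurableSet_Ioo).mp hFae] with t ht htx
      rw [Set.uIoc_of_le hxI.1] at htx
      rw [ht ⟨htx.1, htx.2.trans_lt hx.2⟩]
      change WithLp.toLp 2 ((β x * J * (β t)ᴴ) *ᵥ (F t).ofLp) =
        WithLp.toLp 2 ((β x * J * _) *ᵥ v)
      rw [← Matrix.mulVec_mulVec, hβF, Matrix.mulVec_mulVec]
      rfl
    have hxz : (x : ℂ) - z ≠ 0 := sub_ne_zero.mpr (hz x hxI).symm
    have hone : β x * W x z + Complex.I • (β x * J *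
        ∫ t in a..x, ((t : ℂ) - z)⁻¹ • ((β t)ᴴ * β t * W t z)) = β x := by
      rw [← hrep x hxI, Matrix.mul_sub, Matrix.mul_smul, Matrix.mul_assoc, Matrix.mul_one,
        sub_add_cancel]
    rw [hint, add_sub_right_comm, ← sub_smul]
    simp only [F]
    rw [map_smul, smul_smul, mul_inv_cancel₀ hxz, one_smul, ← map_smul, ← map_add, hone]
    rfl
  have hRF : R z (𝒦 (EuclideanSpace.single q 1)) = hF.toLp := by
    rw [← hsolve]
    exact DFunLike.congr_fun (hR z hz).2 hF.toLp
  rw [Matrix.of_apply, hRF]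
  have hint : (∫ x in a..b, ((β x)ᴴ).mulVec (WithLp.equiv 2 (Fin k → ℂ) (hF.toLp F x))) =
      (∫ t in a..b, ((t : ℂ) - z)⁻¹ • ((β t)ᴴ * β t * W t z)) *ᵥ v := by
    refine Eq.trans ?_ (((Matrix.mulVecBilin ℂ ℂ).flip v).map_intervalIntegral_of_continuousOn
      hab hG)
    rw [intervalIntegral.integral_of_le hab, intervalIntegral.integral_of_le hab,
      integral_Ioc_eq_integral_Ioo, integral_Ioc_eq_integral_Ioo]
    apply integral_congr_ae
    filter_upwards [hFae] with t ht
    rw [ht]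
    exact hβF t
  rw [hint, Matrix.mulVec_single_one]
  rfl
end
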